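/- Let $r = \operatorname{gdepth}(I, N)$ and $J_r = \bigcap_{j < r} \operatorname{ann}_R(\operatorname{Ext}^j_R(R/I, N))$. Then $\dim(R/J_r) \leq 1$ and $r = \inf\{\, i \mid \operatorname{Supp}(H^i_I(N)) \text{ is not finite} \,\} = \inf\{\, i \mid H^i_I(N) \not\cong H^i_{J_r}(N) \,\}$, with the convention $\inf(\emptyset) = +\infty$. -/

import Mathlib

open Opposite CategoryTheory CategoryTheory.Limits TensorProduct

noncomputable section

universe u

/-- `M/IM` as an object of `ModuleCat R`. -/
def modQuot {R : Type u} [CommRing R] (I : Ideal R) (M : ModuleCat.{u} R) : ModuleCat.{u} R :=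
  ModuleCat.of R (M ⧸ (I • ⊤ : Submodule R M))

/-- The Ext module `Ext^j_R(A, B)`. -/
def extMod {R : Type u} [CommRing R] (j : ℕ) (A B : ModuleCat.{u} R) : ModuleCat.{u} R :=
  ((Ext R (ModuleCat.{u} R) j).obj (op A)).obj B

/-- `xs` is a generalized regular sequence of `N` in `J`: each `xⱼ` lies in `J` and avoids all
associated primes `p` of `N/(x₁,...,xⱼ₋₁)N` with `dim(R/p) ≥ 2`. -/
def IsGenRegSeq {R : Type u} [CommRing R] (J : Ideal R) (N : ModuleCat.{u} R)
    (xs : List R) : Prop :=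
  (∀ x ∈ xs, x ∈ J) ∧
  ∀ i : Fin xs.length, ∀ p ∈ associatedPrimes R
      (N ⧸ (Ideal.span {x | x ∈ xs.take i.1} • (⊤ : Submodule R N))),
    (2 : WithBot ℕ∞) ≤ ringKrullDim (R ⧸ p) → xs.get i ∉ p

/-- The generalized depth of `N` in `J`: the supremum of the lengths of generalized regular
sequences of `N` in `J` (this is `+∞` when `dim(N/JN) ≤ 1`, and otherwise the common length
of all maximal generalized regular sequences of `N` in `J`). -/
def gdepth {R : Type u} [CommRing R] (J : Ideal R) (N : ModuleCat.{u} R) : ℕ∞ :=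
  sSup {n : ℕ∞ | ∃ xs : List R, IsGenRegSeq J N xs ∧ (xs.length : ℕ∞) = n}


namespace GDepth

section Comparison
variable {R : Type u} [CommRing R]

/-- the functor `Hom(-, N)` with values in the opposite category -/
abbrev yF (N : ModuleCat.{u} R) : ModuleCat.{u} R ⥤ (ModuleCat.{u} R)ᵒᵖ :=
  ((linearYoneda R (ModuleCat.{u} R)).obj N).rightOp

def yMap {A B : ModuleCat.{u} R} {P : ProjectiveResolution A} {Q : ProjectiveResolution B}
    (N : ModuleCat.{u} R) (φ : P.complex ⟶ Q.complex) :
    Q.complex.linearYonedaObj R N ⟶ P.complex.linearYonedaObj R N :=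
  ((HomologicalComplex.unopFunctor _ _).map ((yF N).mapHomologicalComplex _ |>.map φ).op)

def kap {A : ModuleCat.{u} R} (P : ProjectiveResolution A) (N : ModuleCat.{u} R) (n : ℕ) :
    (P.complex.linearYonedaObj R N).cycles n ⟶
      ((Ext R (ModuleCat.{u} R) n).obj (op A)).obj N :=
  HomologicalComplex.homologyπ _ n ≫ (P.isoExt n N).inv

lemma abs_square {M : Type*} [Category M] {a a' b b' c d : M} (u1 : a ⟶ b) (v1 : b ⟶ c)
    (x : c ⟶ d) (m : b ⟶ b') (v2 : b' ⟶ d) (w : a ⟶ a') (u2 : a' ⟶ b')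
    (h1 : v1 ≫ x = m ≫ v2) (h2 : u1 ≫ m = w ≫ u2) : w ≫ (u2 ≫ v2) = (u1 ≫ v1) ≫ x := by
  rw [Category.assoc, h1, ← Category.assoc, ← Category.assoc, h2]

lemma kap_nat {A B : ModuleCat.{u} R} (f : A ⟶ B) {P : ProjectiveResolution A}
    {Q : ProjectiveResolution B} (φ : P.Hom Q f) (N : ModuleCat.{u} R) (n : ℕ) :
    kap Q N n ≫ ((Ext R (ModuleCat.{u} R) n).map f.op).app N =
      HomologicalComplex.cyclesMap (yMap N φ.hom) n ≫ kap P N n := by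
  have h1 := ProjectiveResolution.isoLeftDerivedObj_hom_naturality f P Q φ.hom
    φ.hom_f_zero_comp_π_f_zero (yF N) n
  have h2 := HomologicalComplex.homologyOp_hom_naturality (yMap N φ.hom) n
  have h3 : HomologicalComplex.homologyMap (yMap N φ.hom) n ≫ (P.isoExt (R := R) n N).inv =
    (Q.isoExt (R := R) n N).inv ≫ ((Ext R (ModuleCat.{u} R) n).map f.op).app N :=
    abs_square _ _ _ _ _ _ _ (congrArg Quiver.Hom.unop h1) (congrArg Quiver.Hom.unop h2)
  unfold kap
  rw [Category.assoc, ← h3]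
  simp

def cyc {A : ModuleCat.{u} R} (P : ProjectiveResolution A) (N : ModuleCat.{u} R) (n : ℕ) :
    (P.complex.linearYonedaObj R N).cycles n →ₗ[R] (P.complex.X n ⟶ N) :=
  ((P.complex.linearYonedaObj R N).iCycles n).hom

lemma yd_apply {A : ModuleCat.{u} R} (P : ProjectiveResolution A) (N : ModuleCat.{u} R) (n m : ℕ)
    (x : P.complex.X n ⟶ N) :
    ((P.complex.linearYonedaObj R N).d n m).hom x = P.complex.d m n ≫ x := rfl

lemma cyc_injective {A : ModuleCat.{u} R} (P : ProjectiveResolution A) (N : ModuleCat.{u} R)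
    (n : ℕ) : Function.Injective (cyc P N n) :=
  (ModuleCat.mono_iff_injective ((P.complex.linearYonedaObj R N).iCycles n)).1 inferInstance

lemma cyc_d {A : ModuleCat.{u} R} (P : ProjectiveResolution A) (N : ModuleCat.{u} R)
    (n : ℕ) (x) : P.complex.d (n + 1) n ≫ cyc P N n x = 0 := by
  have := congrArg (fun f => f.hom x) ((P.complex.linearYonedaObj R N).iCycles_d n (n + 1))
  exact this

lemma exists_cyc {A : ModuleCat.{u} R} (P : ProjectiveResolution A) (N : ModuleCat.{u} R)
    (n : ℕ) (f : P.complex.X n ⟶ N) (hf : P.complex.d (n + 1) n ≫ f = 0) :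
    ∃ x, cyc P N n x = f := by
  refine ⟨HomologicalComplex.cyclesMk (P.complex.linearYonedaObj R N) (i := n) f (n + 1) (by simp) hf, ?_⟩
  exact HomologicalComplex.i_cyclesMk (P.complex.linearYonedaObj R N) (i := n) f (n + 1) (by simp) hf

lemma kap_surj {A : ModuleCat.{u} R} (P : ProjectiveResolution A) (N : ModuleCat.{u} R)
    (n : ℕ) : Function.Surjective (kap P N n).hom := by
  rw [← ModuleCat.epi_iff_surjective]
  unfold kap
  infer_instance

lemma kap_eq_zero {A : ModuleCat.{u} R} (P : ProjectiveResolution A) (N : ModuleCat.{u} R)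
    (n : ℕ) (x) : (kap P N n).hom x = 0 ↔
      ∃ g, ((P.complex.linearYonedaObj R N).toCycles ((ComplexShape.up ℕ).prev n) n).hom g = x := by
  have h1 : (kap P N n).hom x = 0 ↔ ((P.complex.linearYonedaObj R N).homologyπ n).hom x = 0 := by
    unfold kap
    have : Function.Injective ((P.isoExt (R := R) n N).inv).hom :=
      (ModuleCat.mono_iff_injective _).1 inferInstance
    rw [ModuleCat.hom_comp, LinearMap.comp_apply, map_eq_zero_iff _ this]
  rw [h1]
  let S := ShortComplex.mk ((P.complex.linearYonedaObj R N).toCycles ((ComplexShape.up ℕ).prev n) n)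
    ((P.complex.linearYonedaObj R N).homologyπ n) (by simp)
  have hS : S.Exact := S.exact_of_g_is_cokernel
    ((P.complex.linearYonedaObj R N).homologyIsCokernel _ n rfl)
  rw [ShortComplex.moduleCat_exact_iff] at hS
  constructor
  · intro h
    exact hS x h
  · rintro ⟨g, rfl⟩
    exact congrArg (fun f => f.hom g) S.zero

lemma kap_eq_zero_zero {A : ModuleCat.{u} R} (P : ProjectiveResolution A) (N : ModuleCat.{u} R)
    (x) : (kap P N 0).hom x = 0 ↔ cyc P N 0 x = 0 := by
  rw [kap_eq_zero]
  constructor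
  · rintro ⟨g, rfl⟩
    have h : (P.complex.linearYonedaObj R N).toCycles ((ComplexShape.up ℕ).prev 0) 0 = 0 := by
      rw [HomologicalComplex.toCycles_eq_zero]
      simp
    rw [h]
    simp
  · intro h
    rw [map_eq_zero_iff _ (cyc_injective P N 0)] at h
    exact ⟨0, by simp [h]⟩

lemma kap_eq_zero_succ {A : ModuleCat.{u} R} (P : ProjectiveResolution A) (N : ModuleCat.{u} R)
    (n : ℕ) (x) : (kap P N (n + 1)).hom x = 0 ↔
      ∃ g, P.complex.d (n + 1) n ≫ g = cyc P N (n + 1) x := by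
  rw [kap_eq_zero, show (ComplexShape.up ℕ).prev (n + 1) = n by simp]
  have key : ∀ g : P.complex.X n ⟶ N, cyc P N (n + 1)
    (((P.complex.linearYonedaObj R N).toCycles n (n + 1)).hom g) = P.complex.d (n + 1) n ≫ g := by
    intro g
    exact congrArg (fun f => f.hom g) ((P.complex.linearYonedaObj R N).toCycles_i n (n + 1))
  constructor
  · rintro ⟨g, rfl⟩
    exact ⟨g, (key g).symm⟩
  · rintro ⟨g, hg⟩
    exact ⟨g, cyc_injective P N _ ((key g).trans hg)⟩

lemma cyc_map {A B : ModuleCat.{u} R} {P : ProjectiveResolution A}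
    {Q : ProjectiveResolution B} (φ : P.complex ⟶ Q.complex) (N : ModuleCat.{u} R) (n : ℕ) (x) :
    cyc P N n ((HomologicalComplex.cyclesMap (yMap N φ) n).hom x) = φ.f n ≫ cyc Q N n x := by
  exact congrArg (fun f => f.hom x) (HomologicalComplex.cyclesMap_i (yMap N φ) n)

lemma extMk_zero_iff {A : ModuleCat.{u} R} (P : ProjectiveResolution A) (N : ModuleCat.{u} R)
    (f : P.complex.X 0 ⟶ N) (hf : P.complex.d 1 0 ≫ f = 0) :
    P.extMk f 1 rfl hf = 0 ↔ f = 0 := by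
  constructor
  · intro h
    simp only [← P.extEquivCohomologyClass.apply_eq_iff_eq,
      ProjectiveResolution.extEquivCohomologyClass_extMk, ProjectiveResolution.extEquivCohomologyClass_zero,
      CochainComplex.HomComplex.CohomologyClass.mk_eq_zero_iff] at h
    rw [CochainComplex.HomComplex.Cocycle.toSingleMk_mem_coboundaries_iff _ _ _ _ _ 1 (by simp)] at h
    obtain ⟨g, hg⟩ := h
    have hz : IsZero (P.cochainComplex.X 1) := by
      exact P.cochainComplex.isZero_of_isStrictlyLE 0 1
    rw [← cancel_epi (P.cochainComplexXIso (-(0 : ℕ)) 0 rfl).hom]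
    rw [← hg, hz.eq_of_src g 0]
    simp
  · rintro rfl
    simp

/-- The class map from cocycles to the derived-category `Ext`. -/
def alp {A : ModuleCat.{u} R} (P : ProjectiveResolution A) (N : ModuleCat.{u} R) (n : ℕ) :
    (P.complex.linearYonedaObj R N).cycles n →ₗ[R] Abelian.Ext A N n where
  toFun x := P.extMk (cyc P N n x) (n + 1) rfl (cyc_d P N n x)
  map_add' x y := by
    rw [ProjectiveResolution.add_extMk]
    congr 1
    simp
  map_smul' r x := by
    rw [Abelian.Ext.smul_eq_comp_mk₀, ProjectiveResolution.extMk_comp_mk₀]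
    congr 1
    simp

lemma alp_surj {A : ModuleCat.{u} R} (P : ProjectiveResolution A) (N : ModuleCat.{u} R) (n : ℕ) :
    Function.Surjective (alp P N n) := by
  intro e
  obtain ⟨f, hf, rfl⟩ := P.extMk_surjective e (n + 1) rfl
  obtain ⟨x, rfl⟩ := exists_cyc P N n f hf
  exact ⟨x, rfl⟩

lemma ker_alp {A : ModuleCat.{u} R} (P : ProjectiveResolution A) (N : ModuleCat.{u} R) (n : ℕ) :
    LinearMap.ker (alp P N n) = LinearMap.ker (kap P N n).hom := by
  ext x
  rw [LinearMap.mem_ker, LinearMap.mem_ker]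
  cases n with
  | zero => rw [kap_eq_zero_zero]; exact extMk_zero_iff P N _ (cyc_d P N 0 x)
  | succ n => rw [kap_eq_zero_succ]; exact P.extMk_eq_zero_iff _ (n + 2) rfl (cyc_d P N (n + 1) x) n rfl

lemma alp_nat {A B : ModuleCat.{u} R} (f : A ⟶ B) {P : ProjectiveResolution A}
    {Q : ProjectiveResolution B} (φ : P.Hom Q f) (N : ModuleCat.{u} R) (n : ℕ) (x) :
    alp P N n ((HomologicalComplex.cyclesMap (yMap N φ.hom) n).hom x) =
      (Abelian.Ext.mk₀ f).comp (alp Q N n x) (zero_add n) := by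
  simp only [alp, LinearMap.coe_mk, AddHom.coe_mk]
  rw [ProjectiveResolution.mk₀_comp_extMk (φ := φ)]
  congr 1
  exact cyc_map _ _ _ _

/-- Comparison of the two definitions of `Ext`. -/
def cmp (A N : ModuleCat.{u} R) (n : ℕ) :
    Abelian.Ext A N n ≃ₗ[R] ((Ext R (ModuleCat.{u} R) n).obj (op A)).obj N :=
  ((alp (projectiveResolution A) N n).quotKerEquivOfSurjective (alp_surj _ N n)).symm ≪≫ₗ
    Submodule.quotEquivOfEq _ _ (ker_alp _ N n) ≪≫ₗ
    ((kap (projectiveResolution A) N n).hom.quotKerEquivOfSurjective (kap_surj _ N n))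

lemma cmp_alp (A N : ModuleCat.{u} R) (n : ℕ) (x) :
    cmp A N n (alp (projectiveResolution A) N n x) = (kap (projectiveResolution A) N n).hom x := by
  have : ((alp (projectiveResolution A) N n).quotKerEquivOfSurjective (alp_surj _ N n)).symm
    (alp (projectiveResolution A) N n x) = Submodule.Quotient.mk x := by
    rw [LinearEquiv.symm_apply_eq]
    rfl
  simp only [cmp, LinearEquiv.trans_apply]
  rw [this]
  rfl

def someHom {A B : ModuleCat.{u} R} (f : A ⟶ B) (P : ProjectiveResolution A)
    (Q : ProjectiveResolution B) : P.Hom Q f where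
  hom := ProjectiveResolution.lift f P Q
  hom_f_zero_comp_π_f_zero := by
    have := congrArg (fun g => g.f 0) (ProjectiveResolution.lift_commutes f P Q)
    exact this

lemma cmp_nat {A B : ModuleCat.{u} R} (f : A ⟶ B) (N : ModuleCat.{u} R) (n : ℕ)
    (e : Abelian.Ext B N n) :
    cmp A N n ((Abelian.Ext.mk₀ f).comp e (zero_add n)) =
      (((Ext R (ModuleCat.{u} R) n).map f.op).app N).hom (cmp B N n e) := by
  obtain ⟨x, rfl⟩ := alp_surj (projectiveResolution B) N n e
  rw [cmp_alp, ← alp_nat f (someHom f _ _), cmp_alp]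
  exact (congrArg (fun g => g.hom x) (kap_nat f (someHom f (projectiveResolution A) (projectiveResolution B)) N n)).symm

end Comparison
end GDepth

namespace GDepth

section LC
variable {R : Type u} [CommRing R]

abbrev EX (A N : Type u) [AddCommGroup A] [Module R A] [AddCommGroup N] [Module R N] (j : ℕ) :
    Type u := Abelian.Ext.{u} (ModuleCat.of R A) (ModuleCat.of R N) j

/-- restriction along a map in the first variable -/
def res {A B N : Type u} [AddCommGroup A] [Module R A] [AddCommGroup B] [Module R B]
    [AddCommGroup N] [Module R N] (f : A →ₗ[R] B) (j : ℕ) : EX (R := R) B N j →ₗ[R] EX (R := R) A N j where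
  toFun e := (Abelian.Ext.mk₀ (ModuleCat.ofHom f)).comp e (zero_add j)
  map_add' := by simp
  map_smul' := by simp

abbrev fac {I J : Ideal R} (h : I ≤ J) : (R ⧸ I) →ₗ[R] (R ⧸ J) := Submodule.mapQ _ _ LinearMap.id h

lemma lc_interface (I : Ideal R) (i : ℕ) (N : Type u) [AddCommGroup N] [Module R N] :
    ∃ ι : ∀ n : ℕ, EX (R := R) (R ⧸ I ^ n) N i →ₗ[R] (localCohomology I i).obj (ModuleCat.of R N),
      (∀ n m (h : n ≤ m) e, ι m (res (fac (Ideal.pow_le_pow_right h)) i e) = ι n e) ∧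
      (∀ y, ∃ n e, ι n e = y) ∧
      (∀ n e, ι n e = 0 → ∃ m, ∃ h : n ≤ m, res (fac (Ideal.pow_le_pow_right h)) i e = 0) := by
  let D := localCohomology.diagram (localCohomology.idealPowersDiagram I) i
  have : HasColimit D := localCohomology.hasColimitDiagram.{u, 0} _ i
  let c : Cocone (D ⋙ (evaluation _ _).obj (ModuleCat.of R N)) :=
    ((evaluation (ModuleCat.{u} R) (ModuleCat.{u} R)).obj (ModuleCat.of R N)).mapCocone (colimit.cocone D)
  have hc : IsColimit c := isColimitOfPreserves _ (colimit.isColimit D)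
  have : IsFiltered (ℕᵒᵖ)ᵒᵖ := inferInstance
  have : PreservesFilteredColimitsOfSize.{0, 0} (forget (ModuleCat.{u} R)) :=
    preservesFilteredColimitsOfSize_shrink _
  have : PreservesColimit (D ⋙ (evaluation (ModuleCat.{u} R) (ModuleCat.{u} R)).obj (ModuleCat.of R N)) (forget (ModuleCat.{u} R)) := inferInstance
  refine ⟨fun n => (c.ι.app (op (op n))).hom ∘ₗ (cmp (ModuleCat.of R (R ⧸ I ^ n)) (ModuleCat.of R N) i).toLinearMap, ?_, ?_, ?_⟩
  · intro n m h e
    have h2 := c.w (show (op (op n) : (ℕᵒᵖ)ᵒᵖ) ⟶ op (op m) from (homOfLE h).op.op)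
    have h3 := cmp_nat (ModuleCat.ofHom (fac (Ideal.pow_le_pow_right h : I ^ m ≤ I ^ n))) (ModuleCat.of R N) i e
    refine (congrArg (c.ι.app (op (op m))).hom h3).trans ?_
    exact congrArg (fun t => t.hom (cmp (ModuleCat.of R (R ⧸ I ^ n)) (ModuleCat.of R N) i e)) h2
  · intro y
    obtain ⟨⟨⟨n⟩⟩, x, hx⟩ := Concrete.isColimit_exists_rep _ hc y
    refine ⟨n, (cmp (ModuleCat.of R (R ⧸ I ^ n)) (ModuleCat.of R N) i).symm x, ?_⟩
    refine Eq.trans ?_ hx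
    exact congrArg (c.ι.app (op (op n))).hom (LinearEquiv.apply_symm_apply (cmp (ModuleCat.of R (R ⧸ I ^ n)) (ModuleCat.of R N) i) x)
  · intro n e he
    have h1 := (Concrete.isColimit_rep_eq_iff_exists _ hc (i := op (op n)) (j := op (op n))
      (cmp (ModuleCat.of R (R ⧸ I ^ n)) (ModuleCat.of R N) i e) 0).1 (by
        rw [map_zero]; exact he)
    obtain ⟨⟨⟨m⟩⟩, f, g, hfg⟩ := h1
    have hnm : n ≤ m := leOfHom f.unop.unop
    refine ⟨m, hnm, ?_⟩
    have h3 := cmp_nat (ModuleCat.ofHom (fac (Ideal.pow_le_pow_right hnm : I ^ m ≤ I ^ n))) (ModuleCat.of R N) i e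
    rw [map_zero] at hfg
    apply (cmp (ModuleCat.of R (R ⧸ I ^ m)) (ModuleCat.of R N) i).injective
    rw [map_zero]
    exact h3.trans hfg
end LC
end GDepth

namespace GDepth

section EXalg
variable {R : Type u} [CommRing R]
variable {A B C N A' B' C' : Type u} [AddCommGroup A] [Module R A] [AddCommGroup B] [Module R B]
    [AddCommGroup C] [Module R C] [AddCommGroup N] [Module R N]
    [AddCommGroup A'] [Module R A'] [AddCommGroup B'] [Module R B']
    [AddCommGroup C'] [Module R C']

/-- short exact sequence of modules -/
structure SES (f : A →ₗ[R] B) (g : B →ₗ[R] C) : Prop where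
  inj : Function.Injective f
  ex : Function.Exact f g
  surj : Function.Surjective g

/-- the associated short complex -/
abbrev SES.sc {f : A →ₗ[R] B} {g : B →ₗ[R] C} (h : SES f g) : ShortComplex (ModuleCat.{u} R) :=
  ShortComplex.mk (ModuleCat.ofHom f) (ModuleCat.ofHom g) (by
    ext x; exact h.ex.apply_apply_eq_zero x)

lemma SES.se {f : A →ₗ[R] B} {g : B →ₗ[R] C} (h : SES f g) : h.sc.ShortExact where
  exact := (ShortComplex.ShortExact.moduleCat_exact_iff_function_exact _).mpr h.ex
  mono_f := (ModuleCat.mono_iff_injective _).mpr h.inj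
  epi_g := (ModuleCat.epi_iff_surjective _).mpr h.surj

/-- functoriality in the second variable -/
def push (f : A →ₗ[R] B) (j : ℕ) : EX (R := R) N A j →ₗ[R] EX (R := R) N B j where
  toFun e := e.comp (Abelian.Ext.mk₀ (ModuleCat.ofHom f)) (add_zero j)
  map_add' := by simp
  map_smul' := by simp

/-- connecting map, first variable -/
def dl {f : A →ₗ[R] B} {g : B →ₗ[R] C} (h : SES f g) (j : ℕ) :
    EX (R := R) A N j →ₗ[R] EX (R := R) C N (j + 1) where
  toFun e := h.se.extClass.comp e (add_comm 1 j)
  map_add' := by simp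
  map_smul' := by simp

/-- connecting map, second variable -/
def dr {f : A →ₗ[R] B} {g : B →ₗ[R] C} (h : SES f g) (j : ℕ) :
    EX (R := R) N C j →ₗ[R] EX (R := R) N A (j + 1) where
  toFun e := e.comp h.se.extClass rfl
  map_add' := by simp
  map_smul' := by simp

lemma res_comp (f : A →ₗ[R] B) (g : B →ₗ[R] C) (j : ℕ) (e : EX (R := R) C N j) :
    res (g ∘ₗ f) j e = res f j (res g j e) := by
  change (Abelian.Ext.mk₀ (ModuleCat.ofHom (g ∘ₗ f))).comp e (zero_add j) = _
  rw [ModuleCat.ofHom_comp, ← Abelian.Ext.mk₀_comp_mk₀_assoc]; rfl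

lemma res_id (j : ℕ) (e : EX (R := R) A N j) : res LinearMap.id j e = e := by
  exact Abelian.Ext.mk₀_id_comp e

lemma res_smul_id (x : R) (j : ℕ) (e : EX (R := R) A N j) :
    res (x • LinearMap.id) j e = x • e := by
  change (Abelian.Ext.mk₀ (x • (𝟙 (ModuleCat.of R A)))).comp e (zero_add j) = _
  rw [Abelian.Ext.mk₀_smul, Abelian.Ext.smul_comp, Abelian.Ext.mk₀_id_comp]

lemma res_zero (j : ℕ) (e : EX (R := R) B N j) : res (0 : A →ₗ[R] B) j e = 0 := by
  change (Abelian.Ext.mk₀ (0 : (ModuleCat.of R A) ⟶ ModuleCat.of R B)).comp e (zero_add j) = _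
  rw [Abelian.Ext.mk₀_zero, Abelian.Ext.zero_comp]

lemma push_comp (f : A →ₗ[R] B) (g : B →ₗ[R] C) (j : ℕ) (e : EX (R := R) N A j) :
    push (g ∘ₗ f) j e = push g j (push f j e) := by
  change e.comp (Abelian.Ext.mk₀ (ModuleCat.ofHom (g ∘ₗ f))) (add_zero j) = _
  rw [ModuleCat.ofHom_comp, ← Abelian.Ext.mk₀_comp_mk₀, ← Abelian.Ext.comp_assoc_of_third_deg_zero]; rfl

lemma push_id (j : ℕ) (e : EX (R := R) N A j) : push LinearMap.id j e = e := by
  exact Abelian.Ext.comp_mk₀_id e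

lemma push_smul_id (x : R) (j : ℕ) (e : EX (R := R) N A j) :
    push (x • LinearMap.id) j e = x • e := by
  change e.comp (Abelian.Ext.mk₀ (x • (𝟙 (ModuleCat.of R A)))) (add_zero j) = _
  rw [Abelian.Ext.mk₀_smul, Abelian.Ext.comp_smul, Abelian.Ext.comp_mk₀_id]

lemma smul_eq_zero_left (x : R) (hx : ∀ a : A, x • a = 0) (j : ℕ) (e : EX (R := R) A N j) :
    x • e = 0 := by
  rw [← res_smul_id, show (x • LinearMap.id : A →ₗ[R] A) = 0 from LinearMap.ext hx, res_zero]

lemma smul_eq_zero_right (x : R) (hx : ∀ a : A, x • a = 0) (j : ℕ) (e : EX (R := R) N A j) :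
    x • e = 0 := by
  rw [← push_smul_id, show (x • LinearMap.id : A →ₗ[R] A) = 0 from LinearMap.ext hx]
  change e.comp (Abelian.Ext.mk₀ (0 : (ModuleCat.of R A) ⟶ ModuleCat.of R A)) (add_zero j) = _
  rw [Abelian.Ext.mk₀_zero, Abelian.Ext.comp_zero]

variable {f : A →ₗ[R] B} {g : B →ₗ[R] C}

lemma left_exact2 (h : SES f g) (j : ℕ) (e : EX (R := R) B N j) (he : res f j e = 0) :
    ∃ e' : EX (R := R) C N j, res g j e' = e :=
  Abelian.Ext.contravariant_sequence_exact₂ h.se _ e he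

lemma left_exact3 (h : SES f g) (j : ℕ) (e : EX (R := R) C N (j + 1)) (he : res g (j + 1) e = 0) :
    ∃ e' : EX (R := R) A N j, dl h j e' = e :=
  Abelian.Ext.contravariant_sequence_exact₃ h.se _ e he (add_comm 1 j)

lemma right_exact1 (h : SES f g) (j : ℕ) (e : EX (R := R) N A (j + 1)) (he : push f (j + 1) e = 0) :
    ∃ e' : EX (R := R) N C j, dr h j e' = e :=
  Abelian.Ext.covariant_sequence_exact₁ _ h.se e he rfl

lemma right_exact2 (h : SES f g) (j : ℕ) (e : EX (R := R) N B j) (he : push g j e = 0) :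
    ∃ e' : EX (R := R) N A j, push f j e' = e :=
  Abelian.Ext.covariant_sequence_exact₂ _ h.se e he

lemma right_exact3 (h : SES f g) (j : ℕ) (e : EX (R := R) N C j) (he : dr h j e = 0) :
    ∃ e' : EX (R := R) N B j, push g j e' = e :=
  Abelian.Ext.covariant_sequence_exact₃ _ h.se e rfl he

lemma res_surj_zero (hg : Function.Surjective g) (e : EX (R := R) C N 0) (he : res g 0 e = 0) : e = 0 := by
  obtain ⟨φ, rfl⟩ := Abelian.Ext.addEquiv₀.symm.surjective e
  have : Epi (ModuleCat.ofHom g) := (ModuleCat.epi_iff_surjective _).mpr hg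
  have h2 : (Abelian.Ext.mk₀ (ModuleCat.ofHom g)).comp (Abelian.Ext.mk₀ φ) (zero_add 0) = 0 := he
  rw [Abelian.Ext.mk₀_comp_mk₀, Abelian.Ext.mk₀_eq_zero_iff] at h2
  have h3 : φ = 0 := by rw [← cancel_epi (ModuleCat.ofHom g), h2, comp_zero]
  rw [h3, map_zero]

lemma push_inj_zero (hf : Function.Injective f) (e : EX (R := R) N A 0) (he : push f 0 e = 0) : e = 0 := by
  have : Mono (ModuleCat.ofHom f) := (ModuleCat.mono_iff_injective _).mpr hf
  apply Abelian.Ext.postcomp_mk₀_injective_of_mono (ModuleCat.of R N) (ModuleCat.ofHom f)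
  rw [map_zero]; exact he

lemma dl_nat (h : SES f g) {f' : A' →ₗ[R] B'} {g' : B' →ₗ[R] C'} (h' : SES f' g')
    (a : A' →ₗ[R] A) (b : B' →ₗ[R] B) (c : C' →ₗ[R] C)
    (h1 : f ∘ₗ a = b ∘ₗ f') (h2 : g ∘ₗ b = c ∘ₗ g') (j : ℕ) (e : EX (R := R) A N j) :
    res c (j + 1) (dl h j e) = dl h' j (res a j e) := by
  let φ : h'.sc ⟶ h.sc :=
    { τ₁ := ModuleCat.ofHom a, τ₂ := ModuleCat.ofHom b, τ₃ := ModuleCat.ofHom c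
      comm₁₂ := by
        change ModuleCat.ofHom a ≫ ModuleCat.ofHom f = ModuleCat.ofHom f' ≫ ModuleCat.ofHom b
        rw [← ModuleCat.ofHom_comp, h1, ModuleCat.ofHom_comp]
      comm₂₃ := by
        change ModuleCat.ofHom b ≫ ModuleCat.ofHom g = ModuleCat.ofHom g' ≫ ModuleCat.ofHom c
        rw [← ModuleCat.ofHom_comp, h2, ModuleCat.ofHom_comp] }
  have := ShortComplex.ShortExact.extClass_naturality h'.se h.se φ
  change (Abelian.Ext.mk₀ φ.τ₃).comp (h.se.extClass.comp e (add_comm 1 j)) (zero_add (j+1)) = h'.se.extClass.comp ((Abelian.Ext.mk₀ φ.τ₁).comp e (zero_add j)) (add_comm 1 j)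
  rw [← Abelian.Ext.comp_assoc (a₁₂ := 1) _ _ _ (by omega) (by omega) (by omega), ← this,
    Abelian.Ext.comp_assoc (a₂₃ := j) _ _ _ (by omega) (by omega) (by omega)]

/-- degree zero Ext is Hom -/
def ofh (φ : A →ₗ[R] N) : EX (R := R) A N 0 := Abelian.Ext.mk₀ (ModuleCat.ofHom φ)

lemma smul_ofh (x : R) (φ : A →ₗ[R] N) : x • ofh φ = ofh (x • φ) := by
  change _ = Abelian.Ext.mk₀ (x • ModuleCat.ofHom φ)
  rw [Abelian.Ext.mk₀_smul]; rfl

lemma ofh_eq_zero (φ : A →ₗ[R] N) (h : ofh φ = 0) : φ = 0 := by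
  have := (Abelian.Ext.mk₀_eq_zero_iff _).1 h
  exact congrArg ModuleCat.Hom.hom this

instance EX_finite [IsNoetherianRing R] [Module.Finite R A] [Module.Finite R N] (j : ℕ) :
   Module.Finite R (EX (R := R) A N j) := by
  unfold EX; infer_instance

end EXalg
end GDepth

namespace GDepth

section Zp
variable {R : Type u} [CommRing R]

/-- `M` localized at `p` vanishes -/
def Z (p : Ideal R) (M : Type*) [AddCommGroup M] [Module R M] : Prop :=
  ∀ m : M, ∃ s : R, s ∉ p ∧ s • m = 0

lemma Z.unif {p : Ideal R} [p.IsPrime] {M : Type*} [AddCommGroup M] [Module R M] [Module.Finite R M]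
    (h : Z p M) : ∃ s : R, s ∉ p ∧ ∀ m : M, s • m = 0 := by
  obtain ⟨S, hS⟩ := Module.Finite.fg_top (R := R) (M := M)
  choose s hs1 hs2 using h
  refine ⟨∏ m ∈ S, s m, ?_, ?_⟩
  · rw [Ideal.IsPrime.prod_mem_iff]
    push Not
    exact fun m _ => hs1 m
  · intro m
    have hm : m ∈ Submodule.span R (S : Set M) := hS ▸ Submodule.mem_top
    induction hm using Submodule.span_induction with
    | mem x hx =>
      obtain ⟨c, hc⟩ := Finset.dvd_prod_of_mem s hx
      rw [hc, mul_comm, mul_smul, hs2, smul_zero]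
    | zero => exact smul_zero _
    | add x y _ _ hx hy => rw [smul_add, hx, hy, add_zero]
    | smul a x _ hx => rw [smul_comm, hx, smul_zero]

/-- a chain of generalized regular elements, seen at `p` -/
inductive GR (p I : Ideal R) (L : Type u) [AddCommGroup L] [Module R L] :
    ℕ → (M : Type u) → [AddCommGroup M] → [Module R M] → Prop
  | zero (M : Type u) [AddCommGroup M] [Module R M] (e : M ≃ₗ[R] L) : GR p I L 0 M
  | succ (n : ℕ) (M M' : Type u) [AddCommGroup M] [Module R M] [AddCommGroup M'] [Module R M']
      (x : R) (hx : x ∈ I) (hk : ∀ m : M, x • m = 0 → ∃ s, s ∉ p ∧ s • m = 0)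
      (π : M →ₗ[R] M') (hs : Function.Surjective π) (hker : ∀ m, π m = 0 ↔ ∃ m', x • m' = m)
      (h : GR p I L n M') : GR p I L (n + 1) M

section step
variable {M M' : Type u} [AddCommGroup M] [Module R M] [AddCommGroup M'] [Module R M']

lemma ses1 (x : R) : SES (LinearMap.ker (x • (LinearMap.id : M →ₗ[R] M))).subtype
    (x • (LinearMap.id : M →ₗ[R] M)).rangeRestrict where
  inj := Subtype.val_injective
  ex := by
    intro y
    constructor
    · intro h
      exact ⟨⟨y, congrArg Subtype.val h⟩, rfl⟩
    · rintro ⟨z, rfl⟩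
      exact Subtype.ext z.2
  surj := LinearMap.surjective_rangeRestrict _

lemma ses2 (x : R) (π : M →ₗ[R] M') (hs : Function.Surjective π) (hker : ∀ m, π m = 0 ↔ ∃ m', x • m' = m) :
    SES (LinearMap.range (x • (LinearMap.id : M →ₗ[R] M))).subtype π where
  inj := Subtype.val_injective
  ex := by
    intro y
    rw [hker]
    constructor
    · rintro ⟨z, rfl⟩
      exact ⟨⟨x • z, ⟨z, rfl⟩⟩, rfl⟩
    · rintro ⟨⟨_, z, rfl⟩, rfl⟩
      exact ⟨z, rfl⟩
  surj := hs

end step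

variable [IsNoetherianRing R]

lemma part1_step {p I : Ideal R} [p.IsPrime] {M M' : Type u} [AddCommGroup M] [Module R M] [AddCommGroup M'] [Module R M']
    [Module.Finite R M]
      (x : R) (hk : ∀ m : M, x • m = 0 → ∃ s, s ∉ p ∧ s • m = 0)
      (π : M →ₗ[R] M') (hs : Function.Surjective π) (hker : ∀ m, π m = 0 ↔ ∃ m', x • m' = m)
    (A : Type u) [AddCommGroup A] [Module R A] (j : ℕ) (hj : ∀ i, i + 1 = j → Z p (EX (R := R) A M' i))
    (e : EX (R := R) A M j) (he : ∃ s, s ∉ p ∧ s • x • e = 0) : ∃ s, s ∉ p ∧ s • e = 0 := by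
  obtain ⟨s, hsp, hse⟩ := he
  let α := (x • (LinearMap.id : M →ₗ[R] M)).rangeRestrict
  let ι := (LinearMap.range (x • (LinearMap.id : M →ₗ[R] M))).subtype
  have h1 : push ι j (push α j (s • e)) = 0 := by
    rw [← push_comp, show ι ∘ₗ α = x • LinearMap.id from rfl, push_smul_id, smul_comm, hse]
  have h2 : ∃ s' ∉ p, s' • push α j (s • e) = 0 := by
    cases j with
    | zero =>
      refine ⟨1, (Ideal.ne_top_iff_one p).1 (Ideal.IsPrime.ne_top inferInstance), ?_⟩
      rw [push_inj_zero Subtype.val_injective _ h1, smul_zero]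
    | succ i =>
      obtain ⟨f, hf⟩ := right_exact1 (ses2 x π hs hker) i _ h1
      obtain ⟨s', h', h''⟩ := hj i rfl f
      refine ⟨s', h', ?_⟩
      rw [← hf, ← map_smul, h'', map_zero]
  obtain ⟨s', hs', h2⟩ := h2
  rw [← map_smul] at h2
  obtain ⟨k, hk'⟩ := right_exact2 (ses1 x) j _ h2
  have hZ : Z p (LinearMap.ker (x • (LinearMap.id : M →ₗ[R] M))) := by
    rintro ⟨m, hm⟩
    obtain ⟨t, ht, ht'⟩ := hk m hm
    exact ⟨t, ht, Subtype.ext ht'⟩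
  obtain ⟨t, ht, htt⟩ := hZ.unif
  have h3 := smul_eq_zero_right t htt j k
  refine ⟨t * (s' * s), ?_, ?_⟩
  · intro h
    rcases Ideal.IsPrime.mem_or_mem inferInstance h with h | h
    · exact ht h
    rcases Ideal.IsPrime.mem_or_mem inferInstance h with h | h
    · exact hs' h
    · exact hsp h
  · rw [mul_smul, mul_smul, ← hk', ← map_smul, h3, map_zero]

theorem part1 {p I : Ideal R} [p.IsPrime] {L : Type u} [AddCommGroup L] [Module R L] {n : ℕ} {M : Type u}
    [AddCommGroup M] [Module R M] (h : GR p I L n M) : Module.Finite R M →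
    ∀ j, j < n → ∀ (A : Type u) [AddCommGroup A] [Module R A], (∃ k, ∀ x ∈ I ^ k, ∀ a : A, x • a = 0) →
      Z p (EX (R := R) A M j) := by
  induction h with
  | zero M e => intro _ j hj; omega
  | succ n M M' x hx hk π hs hker h ih =>
    intro hM j hj A _ _ ⟨k, hA⟩ e
    have hM' : Module.Finite R M' := Module.Finite.of_surjective π hs
    have step : ∀ (k : ℕ) (e : EX (R := R) A M j), (∃ s, s ∉ p ∧ s • x ^ k • e = 0) → ∃ s, s ∉ p ∧ s • e = 0 := by
      intro k
      induction k with
      | zero => intro e he; simpa using he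
      | succ k ihk =>
        intro e he
        apply part1_step (I := I) x hk π hs hker A j _ e
        · apply ihk
          obtain ⟨s, hs1, hs2⟩ := he
          refine ⟨s, hs1, ?_⟩
          rw [← mul_smul (x ^ k), ← pow_succ, hs2]
        · intro i hi
          exact ih hM' i (by omega) A ⟨_, hA⟩
    apply step k
    refine ⟨1, (Ideal.ne_top_iff_one p).1 (Ideal.IsPrime.ne_top inferInstance), ?_⟩
    rw [smul_eq_zero_left (x ^ k) (hA _ (Ideal.pow_mem_pow hx k)), smul_zero]

theorem part2 {p I : Ideal R} [p.IsPrime] {L : Type u} [AddCommGroup L] [Module R L] {n : ℕ} {M : Type u}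
    [AddCommGroup M] [Module R M] (h : GR p I L n M) : Module.Finite R M →
    ∀ (A : Type u) [AddCommGroup A] [Module R A], (∃ k, ∀ x ∈ I ^ k, ∀ a : A, x • a = 0) →
      ¬ Z p (EX (R := R) A L 0) → ¬ Z p (EX (R := R) A M n) := by
  induction h with
  | zero M e =>
    intro _ A _ _ _ h h'
    apply h
    intro y
    obtain ⟨s, hs, hs'⟩ := h' (push (e.symm : L →ₗ[R] M) 0 y)
    refine ⟨s, hs, ?_⟩
    rw [← map_smul] at hs'
    exact push_inj_zero e.symm.injective _ hs'
  | succ n M M' x hx hk π hs hker h ih =>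
    intro hM A _ _ hA hL hZM
    have hM' : Module.Finite R M' := Module.Finite.of_surjective π hs
    refine ih hM' A hA hL ?_
    intro f
    have hZ : Z p (LinearMap.ker (x • (LinearMap.id : M →ₗ[R] M))) := by
      rintro ⟨m, hm⟩
      obtain ⟨t, ht, ht'⟩ := hk m hm
      exact ⟨t, ht, Subtype.ext ht'⟩
    obtain ⟨t, ht, htt⟩ := hZ.unif
    have h1 : dr (ses1 (M := M) x) (n + 1) (t • dr (ses2 x π hs hker) n f) = 0 := by
      rw [map_smul, smul_eq_zero_right t htt]
    obtain ⟨u, hu⟩ := right_exact3 _ _ _ h1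
    obtain ⟨s, hsp, hs'⟩ := hZM u
    have h2 : dr (ses2 x π hs hker) n ((s * t) • f) = 0 := by
      rw [map_smul, mul_smul, ← hu, ← map_smul, hs', map_zero]
    obtain ⟨v, hv⟩ := right_exact3 _ _ _ h2
    obtain ⟨s', hsp', hv'⟩ := part1 (GR.succ n M M' x hx hk π hs hker h) hM n (by omega) A hA v
    refine ⟨s' * (s * t), ?_, ?_⟩
    · intro h
      rcases Ideal.IsPrime.mem_or_mem inferInstance h with h | h
      · exact hsp' h
      rcases Ideal.IsPrime.mem_or_mem inferInstance h with h | h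
      · exact hsp h
      · exact ht h
    · rw [mul_smul, ← hv, ← map_smul, hv', map_zero]

end Zp
end GDepth

namespace GDepth

section FromSeq
variable {R : Type u} [CommRing R]

lemma dim_quot_mono {p q : Ideal R} (h : q ≤ p) : ringKrullDim (R ⧸ p) ≤ ringKrullDim (R ⧸ q) :=
  ringKrullDim_le_of_surjective (Ideal.Quotient.factor h) (Ideal.Quotient.factor_surjective h)

lemma GR.congr {p I : Ideal R} {L : Type u} [AddCommGroup L] [Module R L] {n : ℕ} {M : Type u}
    [AddCommGroup M] [Module R M] (h : GR p I L n M) : ∀ {M₁ : Type u} [AddCommGroup M₁] [Module R M₁],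
    (M₁ ≃ₗ[R] M) → GR p I L n M₁ := by
  induction h with
  | zero M e => intro M₁ _ _ e'; exact GR.zero _ (e'.trans e)
  | succ n M M' x hx hk π hs hker h ih =>
    intro M₁ _ _ e'
    refine GR.succ n M₁ M' x hx ?_ (π ∘ₗ e'.toLinearMap) (hs.comp e'.surjective) ?_ h
    · intro m hm
      obtain ⟨s, hs, h⟩ := hk (e' m) (by rw [← map_smul, hm, map_zero])
      refine ⟨s, hs, e'.injective (by rw [map_smul, h, map_zero])⟩
    · intro m
      change π (e' m) = 0 ↔ _
      rw [hker]
      constructor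
      · rintro ⟨y, hy⟩
        exact ⟨e'.symm y, e'.injective (by simp [hy])⟩
      · rintro ⟨y, rfl⟩
        exact ⟨e' y, by simp⟩

variable [IsNoetherianRing R]

/-- an element avoiding the big associated primes has small kernel -/
lemma exists_ass_le {M : Type*} [AddCommGroup M] [Module R M] {p : Ideal R} [p.IsPrime] (m : M)
    (h : ∀ s, s ∉ p → s • m ≠ 0) : ∃ q ∈ associatedPrimes R M, q ≤ p ∧ ∀ x : R, x • m = 0 → x ∈ q := by
  have h1 : Module.annihilator R (R ∙ m) ≤ p := by
    intro x hx
    by_contra hxp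
    have := (Module.mem_annihilator.1 hx) ⟨m, Submodule.mem_span_singleton_self m⟩
    exact h x hxp (congrArg Subtype.val this)
  obtain ⟨q, hq, hqp⟩ := Ideal.exists_minimalPrimes_le h1
  have h2 := Module.associatedPrimes.minimalPrimes_annihilator_subset_associatedPrimes R (R ∙ m) hq
  refine ⟨q, associatedPrimes.subset_of_injective (f := (R ∙ m).subtype) Subtype.val_injective h2, hqp, ?_⟩
  intro x hx
  apply hq.1.2
  rw [Module.mem_annihilator]
  rintro ⟨y, hy⟩
  obtain ⟨a, rfl⟩ := Submodule.mem_span_singleton.1 hy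
  apply Subtype.ext
  change x • a • m = 0
  rw [smul_comm, hx, smul_zero]

open scoped Pointwise in
lemma gr_of_seq (I : Ideal R) (N : Type u) [AddCommGroup N] [Module R N] (xs : List R)
    (h : IsGenRegSeq I (ModuleCat.of R N) xs) (p : Ideal R) [p.IsPrime]
    (hp : (2 : WithBot ℕ∞) ≤ ringKrullDim (R ⧸ p)) :
    GR p I (N ⧸ (Ideal.span {x | x ∈ xs} • (⊤ : Submodule R N))) xs.length N := by
  have key : ∀ k i, i + k = xs.length → GR p I (N ⧸ (Ideal.span {x | x ∈ xs} • (⊤ : Submodule R N))) k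
      (N ⧸ (Ideal.span {x | x ∈ xs.take i} • (⊤ : Submodule R N))) := by
    intro k
    induction k with
    | zero =>
      intro i hi
      have : xs.take i = xs := List.take_of_length_le (by omega)
      rw [this]
      exact GR.zero _ (LinearEquiv.refl _ _)
    | succ k ih =>
      intro i hi
      have hlt : i < xs.length := by omega
      have hset : {x | x ∈ xs.take (i+1)} = {x | x ∈ xs.take i} ∪ {xs[i]} := by
        ext x; rw [← List.take_append_getElem hlt]; simp only [List.mem_append, List.mem_singleton, Set.mem_setOf_eq, Set.mem_union, Set.mem_singleton_iff]
      have hsub : Ideal.span {x | x ∈ xs.take (i+1)} • (⊤ : Submodule R N) =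
          Ideal.span {x | x ∈ xs.take i} • (⊤ : Submodule R N) ⊔ xs[i] • (⊤ : Submodule R N) := by
        rw [hset, Ideal.span_union, Submodule.sup_smul, Submodule.ideal_span_singleton_smul]
      refine GR.succ k _ _ xs[i] (h.1 _ (List.getElem_mem hlt)) ?_
        (Submodule.mapQ _ _ LinearMap.id (by rw [hsub]; exact le_sup_left)) ?_ ?_ (ih (i + 1) (by omega))
      · intro m hm
        by_contra hcon
        push Not at hcon
        obtain ⟨q, hq, hqp, hqx⟩ := exists_ass_le m hcon
        exact h.2 ⟨i, hlt⟩ q hq (hp.trans (dim_quot_mono hqp)) (hqx _ hm)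
      · intro y
        obtain ⟨y, rfl⟩ := Submodule.Quotient.mk_surjective _ y
        exact ⟨Submodule.Quotient.mk y, rfl⟩
      · intro m
        obtain ⟨m, rfl⟩ := Submodule.Quotient.mk_surjective _ m
        change (Submodule.Quotient.mk m : N ⧸ (Ideal.span {x | x ∈ xs.take (i+1)} • (⊤ : Submodule R N))) = 0 ↔ _
        rw [Submodule.Quotient.mk_eq_zero, hsub, Submodule.mem_sup]
        constructor
        · rintro ⟨y, hy, z, hz, rfl⟩
          obtain ⟨z, -, rfl⟩ := (Submodule.mem_smul_pointwise_iff_exists _ _ _).1 hz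
          refine ⟨Submodule.Quotient.mk z, ?_⟩
          rw [← Submodule.Quotient.mk_smul, Submodule.Quotient.eq]
          simpa using hy
        · rintro ⟨z, hz⟩
          obtain ⟨z, rfl⟩ := Submodule.Quotient.mk_surjective _ z
          rw [← Submodule.Quotient.mk_smul, Submodule.Quotient.eq] at hz
          refine ⟨m - xs[i] • z, ?_, xs[i] • z, ?_, by abel⟩
          · have := Submodule.neg_mem _ hz
            simpa using this
          · exact Submodule.smul_mem_pointwise_smul _ _ _ Submodule.mem_top
  have h0 := key xs.length 0 (by omega)
  refine h0.congr (Submodule.quotEquivOfEqBot _ ?_).symm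
  simp

lemma not_Z_of_ass {I p : Ideal R} (hI : I ≤ p) (L : Type u) [AddCommGroup L] [Module R L]
    (h : p ∈ associatedPrimes R L) : ¬ Z p (EX (R := R) (R ⧸ I) L 0) := by
  intro hZ
  obtain ⟨hp, l, hl⟩ := isAssociatedPrime_iff.1 h
  have hl' : ∀ x, x ∈ p ↔ x • l = 0 := by
    intro x; rw [hl, Submodule.mem_colon_singleton, Submodule.mem_bot]
  let φ : R ⧸ I →ₗ[R] L := Submodule.liftQ I (LinearMap.toSpanSingleton R L l) (by
    intro x hx
    rw [LinearMap.mem_ker, LinearMap.toSpanSingleton_apply]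
    exact (hl' x).1 (hI hx))
  obtain ⟨s, hs, hs'⟩ := hZ (ofh φ)
  rw [smul_ofh] at hs'
  have := LinearMap.congr_fun (ofh_eq_zero _ hs') (Submodule.Quotient.mk 1)
  apply hs
  rw [hl']
  have h2 : s • (1 : R) • l = 0 := this
  rwa [one_smul] at h2

end FromSeq
end GDepth

namespace GDepth

section Dims
variable {R : Type u} [CommRing R]

lemma dim_le_one_of_finite [IsNoetherianRing R] [IsLocalRing R] (h : Finite (PrimeSpectrum R)) :
    ringKrullDim R ≤ 1 := by
  rw [← IsLocalRing.maximalIdeal_height_eq_ringKrullDim]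
  have h1 : ((IsLocalRing.maximalIdeal R : Ideal R) : Set R) ⊆
      ⋃ q ∈ {q : PrimeSpectrum R | q.asIdeal.height ≤ 1}, (q.asIdeal : Set R) := by
    intro x hx
    have hx' : Ideal.span {x} ≤ IsLocalRing.maximalIdeal R := by
      rwa [Ideal.span_singleton_le_iff_mem]
    obtain ⟨q, hq, hqm⟩ := Ideal.exists_minimalPrimes_le hx'
    have hh := Ideal.height_le_one_of_isPrincipal_of_mem_minimalPrimes (Ideal.span {x}) q hq
    simp only [Set.mem_iUnion]
    exact ⟨⟨q, hq.1.1⟩, hh, hq.1.2 (Ideal.mem_span_singleton_self x)⟩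
  rw [Ideal.subset_union_prime_finite (Set.toFinite _) (IsLocalRing.closedPoint R) (IsLocalRing.closedPoint R)
    (fun i _ _ _ => i.2)] at h1
  obtain ⟨q, hq, hm⟩ := h1
  have := (Ideal.height_mono hm).trans hq
  exact_mod_cast this

lemma zl_infinite [IsNoetherianRing R] [IsLocalRing R] (p : Ideal R) [p.IsPrime]
    (hp : (2 : WithBot ℕ∞) ≤ ringKrullDim (R ⧸ p)) :
    (PrimeSpectrum.zeroLocus (p : Set R)).Infinite := by
  intro hf
  have : Finite (PrimeSpectrum.zeroLocus (p : Set R)) := hf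
  have h2 : Finite (PrimeSpectrum (R ⧸ p)) :=
    Finite.of_equiv _ (p.primeSpectrumQuotientOrderIsoZeroLocus).toEquiv.symm
  have : IsLocalRing (R ⧸ p) := IsLocalRing.of_surjective' (Ideal.Quotient.mk p) Ideal.Quotient.mk_surjective
  have h3 := hp.trans (dim_le_one_of_finite h2)
  exact absurd h3 (by decide)

lemma zl_finite [IsNoetherianRing R] [IsLocalRing R] (J : Ideal R) (h : ringKrullDim (R ⧸ J) ≤ 1) :
    (PrimeSpectrum.zeroLocus (J : Set R)).Finite := by
  rw [ringKrullDim_quotient, Order.krullDim_le_one_iff] at h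
  have h1 := J.finite_minimalPrimes_of_isNoetherianRing R
  have h2 : (insert (IsLocalRing.closedPoint R) (PrimeSpectrum.asIdeal ⁻¹' J.minimalPrimes)).Finite :=
    (h1.preimage (fun a _ b _ h => PrimeSpectrum.ext h)).insert _
  refine h2.subset ?_
  intro x hx
  rcases h ⟨x, hx⟩ with h | h
  · right
    refine ⟨⟨x.2, hx⟩, ?_⟩
    rintro q ⟨hq, hJq⟩ hqx
    exact h (b := ⟨⟨q, hq⟩, hJq⟩) hqx
  · left
    have h3 := h (b := ⟨IsLocalRing.closedPoint R, fun y hy => IsLocalRing.le_maximalIdeal x.2.ne_top (hx hy)⟩)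
      (IsLocalRing.le_maximalIdeal x.2.ne_top)
    exact le_antisymm (IsLocalRing.le_maximalIdeal x.2.ne_top) h3

lemma dim_le_one (J : Ideal R) (h : ∀ p : Ideal R, p.IsPrime → J ≤ p → ¬ (2 : WithBot ℕ∞) ≤ ringKrullDim (R ⧸ p)) :
    ringKrullDim (R ⧸ J) ≤ 1 := by
  by_contra hcon
  rw [ringKrullDim_quotient, Order.krullDim_le_one_iff] at hcon
  push Not at hcon
  obtain ⟨x, hmin, hmax⟩ := hcon
  rw [not_isMin_iff] at hmin
  rw [not_isMax_iff] at hmax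
  obtain ⟨a, ha⟩ := hmin
  obtain ⟨b, hb⟩ := hmax
  refine h a.1.asIdeal a.1.2 a.2 ?_
  rw [ringKrullDim_quotient]
  have hax : a.1.asIdeal ≤ x.1.asIdeal := ha.le
  have hxb : x.1.asIdeal ≤ b.1.asIdeal := hb.le
  let Y := PrimeSpectrum.zeroLocus (a.1.asIdeal : Set R)
  let a' : Y := ⟨a.1, le_refl a.1.asIdeal⟩
  let x' : Y := ⟨x.1, hax⟩
  let b' : Y := ⟨b.1, hax.trans hxb⟩
  have h1 : a' < x' := ha
  have h2 : x' < b' := hb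
  let s : LTSeries Y :=
    { length := 2
      toFun := ![a', x', b']
      step := by
        intro i
        fin_cases i
        · exact h1
        · exact h2 }
  have := Order.LTSeries.length_le_krullDim s
  exact this

variable [IsNoetherianRing R]

lemma seq_bound (I : Ideal R) (N : Type u) [AddCommGroup N] [Module R N] [Module.Finite R N] (xs : List R)
    (h : IsGenRegSeq I (ModuleCat.of R N) xs) (p : Ideal R) [hp' : p.IsPrime]
    (hp : (2 : WithBot ℕ∞) ≤ ringKrullDim (R ⧸ p)) (hI : I ≤ p) (hN : Module.annihilator R N ≤ p) :
    (xs.length : ℕ∞) ≤ p.height := by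
  have key : ∀ i, i ≤ xs.length → ∀ q : Ideal R, q.IsPrime → q ≤ p → Module.annihilator R N ≤ q →
      Ideal.span {x | x ∈ xs.take i} ≤ q → (i : ℕ∞) ≤ q.height := by
    intro i
    induction i with
    | zero => intros; simp
    | succ i ih =>
      intro hi q hq hqp hqN hqx
      have hlt : i < xs.length := by omega
      have hx : Ideal.span {x | x ∈ xs.take i} ≤ q := by
        refine le_trans (Ideal.span_mono ?_) hqx
        intro x hx
        change x ∈ xs.take (i+1)
        rw [← List.take_append_getElem hlt]
        exact List.mem_append_left _ hx
      have hxi : xs[i] ∈ q := by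
        apply hqx
        apply Ideal.subset_span
        change xs[i] ∈ xs.take (i+1)
        rw [← List.take_append_getElem hlt]
        exact List.mem_append_right _ (List.mem_singleton_self _)
      have hsupp : (⟨q, hq⟩ : PrimeSpectrum R) ∈
          Module.support R (N ⧸ (Ideal.span {x | x ∈ xs.take i} • (⊤ : Submodule R N))) := by
        rw [Module.support_quotient, Module.support_eq_zeroLocus]
        exact ⟨hqN, hx⟩
      have hann := hsupp
      rw [Module.support_eq_zeroLocus] at hann
      obtain ⟨q', hq', hqq⟩ := Ideal.exists_minimalPrimes_le (J := q) hann
      have hass := Module.associatedPrimes.minimalPrimes_annihilator_subset_associatedPrimes R _ hq'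
      have hq'p : q'.IsPrime := hq'.1.1
      have hno := h.2 ⟨i, hlt⟩ q' hass (hp.trans (dim_quot_mono (hqq.trans hqp)))
      have hlt' : q' < q := lt_of_le_of_ne hqq (by rintro rfl; exact hno hxi)
      have hs' : (⟨q', hq'p⟩ : PrimeSpectrum R) ∈
          Module.support R (N ⧸ (Ideal.span {x | x ∈ xs.take i} • (⊤ : Submodule R N))) := by
        rw [Module.support_eq_zeroLocus]; exact hq'.1.2
      rw [Module.support_quotient, Module.support_eq_zeroLocus] at hs'
      have h1 := ih (by omega) q' hq'p (hqq.trans hqp) hs'.1 hs'.2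
      have h2 := Ideal.height_add_one_le_of_lt_of_isPrime hlt'
      push_cast
      exact (by gcongr : (i : ℕ∞) + 1 ≤ q'.height + 1).trans h2
  refine key xs.length le_rfl p hp' le_rfl hN ?_
  rw [Ideal.span_le]
  intro x hx
  exact hI (h.1 x (List.mem_of_mem_take hx))

end Dims

section Hr
variable {R : Type u} [CommRing R]

lemma ses_ker {B C : Type u} [AddCommGroup B] [Module R B] [AddCommGroup C] [Module R C] (g : B →ₗ[R] C)
    (hg : Function.Surjective g) : SES (LinearMap.ker g).subtype g where
  inj := Subtype.val_injective
  ex := by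
    intro y
    simp
  surj := hg

lemma fac_surj {I J : Ideal R} (h : I ≤ J) : Function.Surjective (fac h) := by
  intro y
  obtain ⟨y, rfl⟩ := Submodule.Quotient.mk_surjective _ y
  exact ⟨Submodule.Quotient.mk y, rfl⟩

lemma quot_killed (I : Ideal R) (x : R) (hx : x ∈ I) (a : R ⧸ I) : x • a = 0 := by
  obtain ⟨y, rfl⟩ := Submodule.Quotient.mk_surjective _ a
  rw [← Submodule.Quotient.mk_smul, Submodule.Quotient.mk_eq_zero]
  exact Ideal.mul_mem_right _ _ hx

lemma Hr_not_Z (p I : Ideal R) [p.IsPrime] (N : Type u) [AddCommGroup N] [Module R N] (r : ℕ)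
    (h1 : ∀ j, j < r → ∀ (A : Type u) [AddCommGroup A] [Module R A], (∃ k, ∀ x ∈ I ^ k, ∀ a : A, x • a = 0) →
      Z p (EX (R := R) A N j))
    (h2 : ¬ Z p (EX (R := R) (R ⧸ I ^ 1) N r)) :
    ¬ Z p ((localCohomology I r).obj (ModuleCat.of R N)) := by
  intro hZ
  apply h2
  intro e
  obtain ⟨ι, hι1, hι2, hι3⟩ := lc_interface I r N
  obtain ⟨s, hs, hs'⟩ := hZ (ι 1 e)
  rw [← map_smul] at hs'
  obtain ⟨m, hm, h⟩ := hι3 1 _ hs'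
  cases r with
  | zero => exact ⟨s, hs, res_surj_zero (fac_surj _) _ h⟩
  | succ j =>
    obtain ⟨f, hf⟩ := left_exact3 (ses_ker _ (fac_surj _)) j _ h
    obtain ⟨t, ht, ht'⟩ := h1 j (by omega) _ ⟨m, fun x hx a => Subtype.ext (quot_killed _ x hx a.1)⟩ f
    refine ⟨t * s, ?_, ?_⟩
    · intro h
      rcases Ideal.IsPrime.mem_or_mem inferInstance h with h | h
      · exact ht h
      · exact hs h
    · rw [mul_smul, ← hf, ← map_smul, ht', map_zero]

lemma Hr_infinite [IsNoetherianRing R] [IsLocalRing R] (p : Ideal R) [hp : p.IsPrime]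
    (h : (2 : WithBot ℕ∞) ≤ ringKrullDim (R ⧸ p)) (M : Type*) [AddCommGroup M] [Module R M] (hM : ¬ Z p M) :
    ¬ (Module.support R M).Finite := by
  intro hf
  apply zl_infinite p h
  apply hf.subset
  intro q hq
  have : (⟨p, hp⟩ : PrimeSpectrum R) ∈ Module.support R M := by
    by_contra h'
    apply hM
    rw [Module.notMem_support_iff'] at h'
    exact h'
  exact Module.mem_support_mono hq this

end Hr
end GDepth

namespace GDepth

section T
variable {R : Type u} [CommRing R] {N : Type u} [AddCommGroup N] [Module R N]

lemma ker_case {B C : Type u} [AddCommGroup B] [Module R B] [AddCommGroup C] [Module R C]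
    (g : B →ₗ[R] C) (hg : Function.Surjective g) (x : R) (j : ℕ) (e : EX (R := R) C N j)
    (he : res g j e = 0)
    (P : ∀ i, i + 1 = j → ∀ f : EX (R := R) (LinearMap.ker g) N i, ∃ m : ℕ, x ^ m • f = 0) :
    ∃ m : ℕ, x ^ m • e = 0 := by
  cases j with
  | zero => exact ⟨0, by rw [res_surj_zero hg e he, smul_zero]⟩
  | succ j =>
    obtain ⟨f, hf⟩ := left_exact3 (ses_ker g hg) j _ he
    obtain ⟨m, hm⟩ := P j rfl f
    exact ⟨m, by rw [← hf, ← map_smul, hm, map_zero]⟩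

theorem torsion [IsNoetherianRing R] (I J : Ideal R) (x : R) (hx : x ∈ J) (j : ℕ) :
    (∀ i ≤ j, ∀ x ∈ J, ∀ e : EX (R := R) (R ⧸ I) N i, x • e = 0) →
    ∀ (A : Type u) [AddCommGroup A] [Module R A] [Module.Finite R A],
    (∃ k, ∀ x ∈ I ^ k, ∀ a : A, x • a = 0) →
    ∀ e : EX (R := R) A N j, ∃ m : ℕ, x ^ m • e = 0 := by
  induction j using Nat.strong_induction_on with
  | _ j IH =>
  intro H A _ _ hA
  induction hA using IsNoetherianRing.induction_on_isQuotientEquivQuotientPrime R with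
  | subsingleton A =>
    intro _ e
    exact ⟨1, smul_eq_zero_left _ (fun a => Subsingleton.elim _ _) j e⟩
  | quotient A q f =>
    rintro ⟨k, hk⟩ e
    have hIq : I ≤ q.1 := by
      have : I ^ k ≤ q.1 := by
        intro y hy
        have h1 := hk y hy (f.symm (Submodule.Quotient.mk 1))
        rw [← map_smul, f.symm.map_eq_zero_iff, ← Submodule.Quotient.mk_smul,
          Submodule.Quotient.mk_eq_zero] at h1
        simpa using h1
      exact Ideal.IsPrime.le_of_pow_le this
    let g : (R ⧸ I) →ₗ[R] A := f.symm.toLinearMap ∘ₗ fac hIq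
    have hg : Function.Surjective g := f.symm.surjective.comp (fac_surj hIq)
    have h1 : res g j (x • e) = 0 := by
      rw [map_smul]; exact H j le_rfl x hx _
    obtain ⟨m, hm⟩ := ker_case g hg x j (x • e) h1 (by
      intro i hi f'
      refine IH i (by omega) (fun i' hi' => H i' (by omega)) _ ⟨1, ?_⟩ f'
      intro y hy a
      apply Subtype.ext
      exact quot_killed I y (by simpa using hy) a.1)
    exact ⟨m + 1, by rw [pow_succ, mul_smul, hm]⟩
  | exact N₁ N₂ N₃ f g hf hg hfg h₁ h₃ =>
    rintro ⟨k, hk⟩ e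
    obtain ⟨m, hm⟩ := h₁ ⟨k, fun y hy a => hf (by rw [map_smul, hk y hy, map_zero])⟩ (res f j e)
    rw [← map_smul] at hm
    obtain ⟨e', he'⟩ := left_exact2 ⟨hf, hfg, hg⟩ j _ hm
    obtain ⟨m', hm'⟩ := h₃ ⟨k, fun y hy a => by
      obtain ⟨b, rfl⟩ := hg a
      rw [← map_smul, hk y hy, map_zero]⟩ e'
    exact ⟨m' + m, by rw [pow_add, mul_smul, ← he', ← map_smul, hm', map_zero]⟩

lemma exists_sub (J : Ideal R) {B C : Type u} [AddCommGroup B] [Module R B] [AddCommGroup C] [Module R C]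
    (g : B →ₗ[R] C) (hg : Function.Surjective g) (j : ℕ) (e : EX (R := R) C N j)
    (he : res g j e = 0)
    (P : ∀ i, i + 1 = j → ∀ f : EX (R := R) (LinearMap.ker g) N i,
      ∃ m : ℕ, res (J ^ m • (⊤ : Submodule R (LinearMap.ker g))).subtype i f = 0) :
    ∃ m : ℕ, ∀ (B' C' : Type u) [AddCommGroup B'] [Module R B'] [AddCommGroup C'] [Module R C']
      (g' : B' →ₗ[R] C') (b : B' →ₗ[R] B) (c : C' →ₗ[R] C), Function.Surjective g' →
      g ∘ₗ b = c ∘ₗ g' → (∀ y, g' y = 0 → b y ∈ J ^ m • LinearMap.ker g) → res c j e = 0 := by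
  cases j with
  | zero =>
    refine ⟨0, ?_⟩
    intro B' C' _ _ _ _ g' b c _ _ _
    rw [res_surj_zero hg e he, map_zero]
  | succ j =>
    obtain ⟨f, hf⟩ := left_exact3 (ses_ker g hg) j _ he
    obtain ⟨m, hm⟩ := P j rfl f
    refine ⟨m, ?_⟩
    intro B' C' _ _ _ _ g' b c hg' h2 hb
    set K := LinearMap.ker g
    have hS : (J ^ m • (⊤ : Submodule R K)).map K.subtype = J ^ m • K := by
      rw [Submodule.map_smul'', Submodule.map_top, Submodule.range_subtype]
    have hb1 : ∀ y : LinearMap.ker g', b y.1 ∈ K := fun y =>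
      Submodule.smul_le_right (hb y.1 y.2)
    let a : LinearMap.ker g' →ₗ[R] K := (b ∘ₗ (LinearMap.ker g').subtype).codRestrict K hb1
    have ha : ∀ y, a y ∈ J ^ m • (⊤ : Submodule R K) := by
      intro y
      have := hb y.1 y.2
      rw [← hS] at this
      obtain ⟨z, hz, hz'⟩ := this
      have : a y = z := Subtype.ext hz'.symm
      rwa [this]
    have h3 : a = (J ^ m • (⊤ : Submodule R K)).subtype ∘ₗ a.codRestrict _ ha := rfl
    rw [← hf, dl_nat (ses_ker g hg) (ses_ker g' hg') a b c rfl h2, h3, res_comp, hm, map_zero, map_zero]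

/-- every class vanishes on a power of `J` -/
def VJ (J : Ideal R) (N : Type u) [AddCommGroup N] [Module R N] (i : ℕ) (K : Type u) [AddCommGroup K] [Module R K] : Prop :=
  ∀ f : EX (R := R) K N i, ∃ m : ℕ, res (J ^ m • (⊤ : Submodule R K)).subtype i f = 0

lemma single [IsNoetherianRing R] (J : Ideal R) (x : R) (hx : x ∈ J) (j : ℕ)
    (A : Type u) [AddCommGroup A] [Module R A] [Module.Finite R A]
    (e : EX (R := R) A N j) (he : ∃ m : ℕ, x ^ m • e = 0)
    (P : ∀ i, i + 1 = j → ∀ K : Submodule R A, VJ J N i K) :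
    ∃ C : Submodule R A, res C.subtype j e = 0 ∧ ∃ n : ℕ, ∀ a : A, x ^ n • a ∈ C := by
  obtain ⟨m, hm⟩ := he
  let φ : A →ₗ[R] A := x ^ m • LinearMap.id
  have h1 : res φ.rangeRestrict j (res φ.range.subtype j e) = 0 := by
    rw [← res_comp, LinearMap.subtype_comp_codRestrict, res_smul_id, hm]
  obtain ⟨k, hk⟩ := exists_sub J φ.rangeRestrict φ.surjective_rangeRestrict j _ h1
    (fun i hi f => P i hi _ f)
  obtain ⟨k0, hk0⟩ := Ideal.exists_pow_inf_eq_pow_smul J (LinearMap.ker φ.rangeRestrict)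
  let D : Submodule R A := J ^ (k0 + k) • ⊤
  have hD : ∀ y : D, φ y.1 ∈ D.map φ := fun y => ⟨y.1, y.2, rfl⟩
  have hC : D.map φ ≤ φ.range := LinearMap.map_le_range
  refine ⟨D.map φ, ?_, m + (k0 + k), ?_⟩
  · have := hk D (D.map φ) ((φ ∘ₗ D.subtype).codRestrict _ hD) D.subtype (Submodule.inclusion hC) ?_ rfl ?_
    · rw [← res_comp] at this
      exact this
    · rintro ⟨_, y, hy, rfl⟩
      exact ⟨⟨y, hy⟩, rfl⟩
    · intro y hy
      have hy1 : φ y.1 = 0 := congrArg Subtype.val hy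
      have h2 : y.1 ∈ J ^ (k0 + k) • ⊤ ⊓ LinearMap.ker φ.rangeRestrict := ⟨y.2, Subtype.ext hy1⟩
      rw [hk0 _ (by omega), show k0 + k - k0 = k by omega] at h2
      exact Submodule.smul_mono le_rfl inf_le_right h2
  · intro a
    refine ⟨x ^ (k0 + k) • a, Submodule.smul_mem_smul (Ideal.pow_mem_pow hx _) trivial, ?_⟩
    change x ^ m • (x ^ (k0 + k) • a) = _
    rw [← mul_smul, ← pow_add]

lemma multi [IsNoetherianRing R] (J : Ideal R) (j : ℕ)
    (A : Type u) [AddCommGroup A] [Module R A] [Module.Finite R A]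
    (e : EX (R := R) A N j)
    (T : ∀ (C : Submodule R A) (e : EX (R := R) (A ⧸ C) N j) (x : R), x ∈ J → ∃ m : ℕ, x ^ m • e = 0)
    (P : ∀ i, i + 1 = j → ∀ (C : Submodule R A) (K : Submodule R (A ⧸ C)), VJ J N i K) :
    ∃ m : ℕ, res (J ^ m • (⊤ : Submodule R A)).subtype j e = 0 := by
  classical
  have key : ∀ S : Finset R, (∀ x ∈ S, x ∈ J) → ∃ C : Submodule R A, res C.subtype j e = 0 ∧
      ∀ x ∈ S, ∃ n : ℕ, ∀ a : A, x ^ n • a ∈ C := by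
    intro S
    induction S using Finset.induction_on with
    | empty =>
      intro _
      refine ⟨⊥, ?_, by simp⟩
      rw [show (⊥ : Submodule R A).subtype = 0 from LinearMap.ext (fun x => (Submodule.mem_bot R).1 x.2),
        res_zero]
    | insert x S hxS ih =>
      intro hS
      obtain ⟨C, hC, hC'⟩ := ih (fun y hy => hS y (Finset.mem_insert_of_mem hy))
      have hses : SES C.subtype C.mkQ := ⟨C.injective_subtype,
        LinearMap.exact_subtype_mkQ C, C.mkQ_surjective⟩
      obtain ⟨e', he'⟩ := left_exact2 hses j e hC
      have hxJ := hS x (Finset.mem_insert_self _ _)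
      obtain ⟨C', h1, n, h2⟩ := single J x hxJ j (A ⧸ C) e' (T C e' x hxJ) (fun i hi => P i hi C)
      refine ⟨C'.comap C.mkQ, ?_, ?_⟩
      · rw [← he', ← res_comp]
        have : C.mkQ ∘ₗ (C'.comap C.mkQ).subtype =
          C'.subtype ∘ₗ (C.mkQ ∘ₗ (C'.comap C.mkQ).subtype).codRestrict C' (fun y => y.2) := rfl
        rw [this, res_comp, h1, map_zero]
      · intro y hy
        rcases Finset.mem_insert.1 hy with rfl | hy
        · exact ⟨n, fun a => by
            rw [Submodule.mem_comap, map_smul]; exact h2 _⟩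
        · obtain ⟨n', hn'⟩ := hC' y hy
          refine ⟨n', fun a => ?_⟩
          rw [Submodule.mem_comap, Submodule.mkQ_apply, (Submodule.Quotient.mk_eq_zero _).2 (hn' a)]
          exact zero_mem _
  obtain ⟨S, hS⟩ := (IsNoetherian.noetherian J)
  obtain ⟨C, hC, hC'⟩ := key S (fun x hx => hS ▸ Submodule.subset_span hx)
  let c : Ideal R := (Module.annihilator R (A ⧸ C))
  have hc : J ≤ c.radical := by
    rw [← hS]
    apply Submodule.span_le.2
    intro x hx
    obtain ⟨n, hn⟩ := hC' x hx
    refine ⟨n, Module.mem_annihilator.2 ?_⟩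
    intro a
    obtain ⟨a, rfl⟩ := Submodule.Quotient.mk_surjective _ a
    rw [← Submodule.Quotient.mk_smul, Submodule.Quotient.mk_eq_zero]
    exact hn a
  obtain ⟨n, hn⟩ := Ideal.exists_pow_le_of_le_radical_of_fg hc (IsNoetherian.noetherian J)
  refine ⟨n, ?_⟩
  have hle : J ^ n • (⊤ : Submodule R A) ≤ C := by
    rw [Submodule.smul_le]
    intro y hy a _
    have := Module.mem_annihilator.1 (hn hy) (Submodule.Quotient.mk a)
    rwa [← Submodule.Quotient.mk_smul, Submodule.Quotient.mk_eq_zero] at this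
  rw [← Submodule.subtype_comp_inclusion _ _ hle, res_comp, hC, map_zero]

theorem vanish [IsNoetherianRing R] (I J : Ideal R) (j : ℕ) :
    (∀ i ≤ j, ∀ x ∈ J, ∀ e : EX (R := R) (R ⧸ I) N i, x • e = 0) →
    ∀ (A : Type u) [AddCommGroup A] [Module R A] [Module.Finite R A],
    (∃ k, ∀ x ∈ I ^ k, ∀ a : A, x • a = 0) →
    ∀ e : EX (R := R) A N j, ∃ m : ℕ, res (J ^ m • (⊤ : Submodule R A)).subtype j e = 0 := by
  induction j using Nat.strong_induction_on with
  | _ j IH =>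
  rintro H A _ _ _ ⟨k, hk⟩ e
  have hq : ∀ C : Submodule R A, ∀ x ∈ I ^ k, ∀ a : A ⧸ C, x • a = 0 := by
    intro C x hx a
    obtain ⟨a, rfl⟩ := Submodule.Quotient.mk_surjective _ a
    rw [← Submodule.Quotient.mk_smul, hk x hx, Submodule.Quotient.mk_zero]
  refine multi J j A e ?_ ?_
  · intro C e' x hx
    exact torsion I J x hx j H (A ⧸ C) ⟨k, hq C⟩ e'
  · intro i hi C K f
    exact IH i (by omega) (fun i' hi' => H i' (by omega)) K ⟨k, fun x hx a => Subtype.ext (hq C x hx a.1)⟩ f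

end T
end GDepth

namespace GDepth

section colim
variable {R : Type*} [CommRing R]

lemma colim_map {X Y : ℕ → Type*} [∀ n, AddCommGroup (X n)] [∀ n, Module R (X n)]
    [∀ n, AddCommGroup (Y n)] [∀ n, Module R (Y n)]
    {HX HY : Type*} [AddCommGroup HX] [Module R HX] [AddCommGroup HY] [Module R HY]
    (tX : ∀ n m, n ≤ m → X n →ₗ[R] X m) (tY : ∀ n m, n ≤ m → Y n →ₗ[R] Y m)
    (κ : ∀ n, X n →ₗ[R] HX) (ι : ∀ n, Y n →ₗ[R] HY) (ρ : ∀ n, X n →ₗ[R] Y n)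
    (hρ : ∀ n m h e, ρ m (tX n m h e) = tY n m h (ρ n e))
    (κ1 : ∀ n m h e, κ m (tX n m h e) = κ n e) (κ2 : ∀ y, ∃ n e, κ n e = y)
    (κ3 : ∀ n e, κ n e = 0 → ∃ m h, tX n m h e = 0)
    (ι1 : ∀ n m h e, ι m (tY n m h e) = ι n e) (ι2 : ∀ y, ∃ n e, ι n e = y)
    (ι3 : ∀ n e, ι n e = 0 → ∃ m h, tY n m h e = 0)
    (inj : ∀ n e, ρ n e = 0 → ∃ m h, tX n m h e = 0)
    (surj : ∀ n e, ∃ m h e', ρ m e' = tY n m h e) : Nonempty (HX ≃ₗ[R] HY) := by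
  have k0 : ∀ n e, κ n e = 0 → ι n (ρ n e) = 0 := by
    intro n e h
    obtain ⟨m, h, h'⟩ := κ3 n e h
    rw [← ι1 n m h, ← hρ, h', map_zero, map_zero]
  have key : ∀ n e n' e', κ n e = κ n' e' → ι n (ρ n e) = ι n' (ρ n' e') := by
    intro n e n' e' h
    rw [← κ1 n (max n n') (le_max_left _ _), ← κ1 n' (max n n') (le_max_right _ _), ← sub_eq_zero,
      ← map_sub] at h
    have := k0 _ _ h
    rwa [map_sub, map_sub, hρ, hρ, ι1, ι1, sub_eq_zero] at this
  choose nn ee hh using κ2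
  let Φ : HX → HY := fun y => ι _ (ρ _ (ee y))
  have hΦ : ∀ n e, Φ (κ n e) = ι n (ρ n e) := fun n e => key _ _ _ _ (hh _)
  let L : HX →ₗ[R] HY :=
    { toFun := Φ
      map_add' := by
        intro x y
        have : x + y = κ (max (nn x) (nn y)) (tX _ _ (le_max_left _ _) (ee x) + tX _ _ (le_max_right _ _) (ee y)) := by
          rw [map_add, κ1, κ1, hh, hh]
        rw [this, hΦ, map_add, map_add, hρ, hρ, ι1, ι1]
      map_smul' := by
        intro a x
        have : a • x = κ (nn x) (a • ee x) := by
          rw [map_smul, hh]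
        rw [this, hΦ, map_smul, map_smul]; rfl }
  refine ⟨LinearEquiv.ofBijective L ⟨?_, ?_⟩⟩
  · rw [injective_iff_map_eq_zero]
    intro y hy
    rw [← hh y] at hy ⊢
    change Φ _ = 0 at hy
    rw [hΦ] at hy
    obtain ⟨m, h, h'⟩ := ι3 _ _ hy
    rw [← hρ] at h'
    obtain ⟨m', h1, h2⟩ := inj _ _ h'
    rw [← κ1 _ m h, ← κ1 _ m' h1, h2, map_zero]
  · intro z
    obtain ⟨n, e, rfl⟩ := ι2 z
    obtain ⟨m, h, e', he'⟩ := surj n e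
    refine ⟨κ m e', ?_⟩
    change Φ _ = _
    rw [hΦ, he', ι1]

end colim

section iso
variable {R : Type u} [CommRing R] [IsNoetherianRing R] {N : Type u} [AddCommGroup N] [Module R N]

lemma iso_comm (I J : Ideal R) (hIJ : I ≤ J) (j : ℕ) (n m : ℕ) (h : n ≤ m) (e : EX (R := R) (R ⧸ J ^ n) N j) :
    res (fac (Ideal.pow_right_mono hIJ m)) j (res (fac (Ideal.pow_le_pow_right h)) j e) =
    res (fac (Ideal.pow_le_pow_right h)) j (res (fac (Ideal.pow_right_mono hIJ n)) j e) := by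
  rw [← res_comp, ← res_comp]
  congr 2
  ext x
  rfl

lemma iso_inj (I J : Ideal R) (hIJ : I ≤ J) (j : ℕ)
    (H : ∀ i ≤ j, ∀ x ∈ J, ∀ e : EX (R := R) (R ⧸ I) N i, x • e = 0) (n : ℕ)
    (e : EX (R := R) (R ⧸ J ^ n) N j) (he : res (fac (Ideal.pow_right_mono hIJ n)) j e = 0) :
    ∃ m, ∃ h : n ≤ m, res (fac (Ideal.pow_le_pow_right (I := J) h)) j e = 0 := by
  obtain ⟨k, hk⟩ := exists_sub J (fac (Ideal.pow_right_mono hIJ n)) (fac_surj _) j e he (by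
    intro i hi f
    refine vanish I J i (fun i' hi' => H i' (by omega)) _ ⟨n, ?_⟩ f
    intro x hx a
    exact Subtype.ext (quot_killed _ x hx a.1))
  refine ⟨k + n, by omega, ?_⟩
  refine hk R (R ⧸ J ^ (k + n)) (J ^ (k + n)).mkQ (I ^ n).mkQ _ (Submodule.mkQ_surjective _) ?_ ?_
  · ext
    rfl
  · intro y hy
    have hy : y ∈ J ^ (k + n) := (Submodule.Quotient.mk_eq_zero _).1 hy
    have h1 : (I ^ n).mkQ y ∈ Submodule.map (I ^ n).mkQ (J ^ k • (J ^ n : Submodule R R)) := by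
      refine ⟨y, ?_, rfl⟩
      rw [pow_add] at hy
      exact hy
    rw [Submodule.map_smul''] at h1
    refine Submodule.smul_mono le_rfl ?_ h1
    rintro _ ⟨z, hz, rfl⟩
    change Submodule.Quotient.mk z = _
    exact (Submodule.Quotient.mk_eq_zero _).2 hz
lemma iso_surj (I J : Ideal R) (hIJ : I ≤ J) (j : ℕ)
    (H : ∀ i ≤ j, ∀ x ∈ J, ∀ e : EX (R := R) (R ⧸ I) N i, x • e = 0) (n : ℕ)
    (e : EX (R := R) (R ⧸ I ^ n) N j) :
    ∃ m, ∃ h : n ≤ m, ∃ e' : EX (R := R) (R ⧸ J ^ m) N j, res (fac (Ideal.pow_right_mono hIJ m)) j e' =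
      res (fac (Ideal.pow_le_pow_right (I := I) h)) j e := by
  obtain ⟨m, hm⟩ := vanish I J j H (R ⧸ I ^ n) ⟨n, fun x hx a => quot_killed _ x hx a⟩ e
  set C := J ^ m • (⊤ : Submodule R (R ⧸ I ^ n)) with hC
  have hses : SES C.subtype C.mkQ := ⟨C.injective_subtype,
      LinearMap.exact_subtype_mkQ C, C.mkQ_surjective⟩
  obtain ⟨e', he'⟩ := left_exact2 hses j e hm
  let M := max m n
  have hM : (J ^ M : Submodule R R) ≤ LinearMap.ker (C.mkQ ∘ₗ (I ^ n).mkQ) := by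
    intro y hy
    have hy : y ∈ J ^ m := Ideal.pow_le_pow_right (le_max_left _ _) hy
    rw [LinearMap.mem_ker, LinearMap.comp_apply, Submodule.mkQ_apply, Submodule.Quotient.mk_eq_zero]
    have : (I ^ n).mkQ y = y • (I ^ n).mkQ 1 := by rw [← map_smul]; simp
    rw [this]
    exact Submodule.smul_mem_smul hy trivial
  let q : (R ⧸ J ^ M) →ₗ[R] ((R ⧸ I ^ n) ⧸ C) := Submodule.liftQ _ (C.mkQ ∘ₗ (I ^ n).mkQ) hM
  refine ⟨M, le_max_right _ _, res q j e', ?_⟩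
  rw [← he', ← res_comp, ← res_comp]
  congr 2
  ext
  rfl

lemma iso_abs (I J : Ideal R) (hIJ : I ≤ J) (j : ℕ)
    (H : ∀ i ≤ j, ∀ x ∈ J, ∀ e : EX (R := R) (R ⧸ I) N i, x • e = 0)
    (HX HY : Type u) [AddCommGroup HX] [Module R HX] [AddCommGroup HY] [Module R HY]
    (κ : ∀ n, EX (R := R) (R ⧸ J ^ n) N j →ₗ[R] HX) (ι : ∀ n, EX (R := R) (R ⧸ I ^ n) N j →ₗ[R] HY)
    (κ1 : ∀ n m (h : n ≤ m) e, κ m (res (fac (Ideal.pow_le_pow_right h)) j e) = κ n e)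
    (κ2 : ∀ y, ∃ n e, κ n e = y)
    (κ3 : ∀ n e, κ n e = 0 → ∃ m, ∃ h : n ≤ m, res (fac (Ideal.pow_le_pow_right h)) j e = 0)
    (ι1 : ∀ n m (h : n ≤ m) e, ι m (res (fac (Ideal.pow_le_pow_right h)) j e) = ι n e)
    (ι2 : ∀ y, ∃ n e, ι n e = y)
    (ι3 : ∀ n e, ι n e = 0 → ∃ m, ∃ h : n ≤ m, res (fac (Ideal.pow_le_pow_right h)) j e = 0) :
    Nonempty (HX ≃ₗ[R] HY) := by
  refine colim_map (X := fun n => EX (R := R) (R ⧸ J ^ n) N j) (Y := fun n => EX (R := R) (R ⧸ I ^ n) N j)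
    (fun n m h => res (fac (Ideal.pow_le_pow_right h)) j)
    (fun n m h => res (fac (Ideal.pow_le_pow_right h)) j) κ ι
    (fun n => res (fac (Ideal.pow_right_mono hIJ n)) j) ?_ ?_ ?_ ?_ ?_ ?_ ?_ ?_ ?_
  · intro n m h e; exact iso_comm I J hIJ j n m h e
  · exact κ1
  · exact κ2
  · exact κ3
  · exact ι1
  · exact ι2
  · exact ι3
  · intro n e he; exact iso_inj I J hIJ j H n e he
  · intro n e; exact iso_surj I J hIJ j H n e

theorem iso_lc (I J : Ideal R) (hIJ : I ≤ J) (j : ℕ)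
    (H : ∀ i ≤ j, ∀ x ∈ J, ∀ e : EX (R := R) (R ⧸ I) N i, x • e = 0) :
    Nonempty ((localCohomology J j).obj (ModuleCat.of R N) ≃ₗ[R]
      (localCohomology I j).obj (ModuleCat.of R N)) := by
  obtain ⟨ι, ι1, ι2, ι3⟩ := lc_interface I j N
  obtain ⟨κ, κ1, κ2, κ3⟩ := lc_interface J j N
  exact iso_abs I J hIJ j H _ _ κ ι κ1 κ2 κ3 ι1 ι2 ι3

lemma support_lc (J : Ideal R) (j : ℕ) :
    Module.support R ((localCohomology J j).obj (ModuleCat.of R N)) ⊆ PrimeSpectrum.zeroLocus J := by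
  obtain ⟨κ, κ1, κ2, κ3⟩ := lc_interface J j N
  intro p hp
  rw [PrimeSpectrum.mem_zeroLocus]
  intro x hx
  by_contra hxp
  refine (Module.notMem_support_iff'.2 ?_) hp
  intro y
  obtain ⟨n, e, rfl⟩ := κ2 y
  refine ⟨x ^ n, fun h => hxp (p.2.mem_of_pow_mem n h), ?_⟩
  rw [← map_smul, smul_eq_zero_left _ (fun a => quot_killed _ _ (Ideal.pow_mem_pow hx n) a), map_zero]

end iso
end GDepth

namespace GDepth

section fin
variable {R : Type u} [CommRing R]

lemma mem_ann_iff (I : Ideal R) (N : Type u) [AddCommGroup N] [Module R N] (j : ℕ) (x : R) :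
    x ∈ Module.annihilator R (extMod j (ModuleCat.of R (R ⧸ I)) (ModuleCat.of R N)) ↔
      ∀ e : EX (R := R) (R ⧸ I) N j, x • e = 0 := by
  rw [Module.mem_annihilator]
  let φ := cmp (ModuleCat.of R (R ⧸ I)) (ModuleCat.of R N) j
  constructor
  · intro h e
    apply φ.injective
    rw [map_smul, map_zero]
    exact h (φ e)
  · intro h y
    obtain ⟨e, rfl⟩ := φ.surjective y
    have := congrArg φ (h e)
    rw [map_smul, map_zero] at this
    exact this

lemma r_eq_sInf (r : ℕ∞) (P : ℕ → Prop) (h1 : ∀ j : ℕ, (j : ℕ∞) < r → ¬ P j)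
    (h2 : ∀ n : ℕ, r = n → P n) : r = sInf {i : ℕ∞ | ∃ j : ℕ, i = (j : ℕ∞) ∧ P j} := by
  apply le_antisymm
  · apply le_sInf
    rintro _ ⟨j, rfl, hj⟩
    by_contra h
    exact h1 j (not_le.1 h) hj
  · induction r using ENat.recTopCoe with
    | top => exact le_top
    | coe n => exact sInf_le ⟨n, rfl, h2 n rfl⟩

lemma ass_congr (N : Type u) [AddCommGroup N] [Module R N] (p : Ideal R) (l l' : List R) (h : l = l')
    (hp : p ∈ associatedPrimes R (N ⧸ (Ideal.span {x | x ∈ l} • (⊤ : Submodule R N)))) :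
    p ∈ associatedPrimes R (N ⧸ (Ideal.span {x | x ∈ l'} • (⊤ : Submodule R N))) := by
  subst h; exact hp

lemma seq_snoc (I : Ideal R) (N : Type u) [AddCommGroup N] [Module R N] (xs : List R)
    (h : IsGenRegSeq I (ModuleCat.of R N) xs) (x : R) (hx : x ∈ I)
    (hx' : ∀ p ∈ associatedPrimes R (N ⧸ (Ideal.span {x | x ∈ xs} • (⊤ : Submodule R N))),
      (2 : WithBot ℕ∞) ≤ ringKrullDim (R ⧸ p) → x ∉ p) :
    IsGenRegSeq I (ModuleCat.of R N) (xs ++ [x]) := by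
  refine ⟨?_, ?_⟩
  · intro y hy
    rcases List.mem_append.1 hy with hy | hy
    · exact h.1 y hy
    · rw [List.mem_singleton.1 hy]; exact hx
  · rintro ⟨i, hi⟩ p hp hd
    by_cases hlt : i < xs.length
    · have h1 := h.2 ⟨i, hlt⟩ p
      have h2 : (xs ++ [x]).take i = xs.take i := List.take_append_of_le_length hlt.le
      have h3 := h1 (ass_congr N p _ _ h2 hp) hd
      simpa [List.getElem_append_left hlt] using h3
    · have hi' : i = xs.length := by
        simp at hi; omega
      subst hi'
      have h2 : (xs ++ [x]).take xs.length = xs := List.take_left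
      have h3 := hx' p (ass_congr N p _ _ h2 hp) hd
      simpa using h3

lemma exists_ass [IsNoetherianRing R] (I : Ideal R) (N : Type u) [AddCommGroup N] [Module R N]
    [Module.Finite R N] (xs : List R)
    (h : IsGenRegSeq I (ModuleCat.of R N) xs)
    (hmax : ∀ x, ¬ IsGenRegSeq I (ModuleCat.of R N) (xs ++ [x])) :
    ∃ p ∈ associatedPrimes R (N ⧸ (Ideal.span {x | x ∈ xs} • (⊤ : Submodule R N))),
      (2 : WithBot ℕ∞) ≤ ringKrullDim (R ⧸ p) ∧ I ≤ p := by
  by_contra hcon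
  push Not at hcon
  let T := {p ∈ associatedPrimes R (N ⧸ (Ideal.span {x | x ∈ xs} • (⊤ : Submodule R N))) |
    (2 : WithBot ℕ∞) ≤ ringKrullDim (R ⧸ p)}
  have hT : T.Finite := (associatedPrimes.finite R _).subset (Set.sep_subset _ _)
  have h1 : ¬ ((I : Set R) ⊆ ⋃ p ∈ T, (p : Set R)) := by
    intro hsub
    rw [Ideal.subset_union_prime_finite hT (f := fun p => p) ⊥ ⊥ (fun p hp _ _ => hp.1.isPrime)] at hsub
    obtain ⟨p, hp, hp'⟩ := hsub
    exact hcon p hp.1 hp.2 hp'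
  obtain ⟨x, hx, hx'⟩ := Set.not_subset.1 h1
  refine hmax x (seq_snoc I N xs h x hx ?_)
  intro p hp hd hxp
  exact hx' (Set.mem_biUnion (show p ∈ T from ⟨hp, hd⟩) hxp)

lemma inf_support [IsNoetherianRing R] [IsLocalRing R] (I : Ideal R) (N : Type u) [AddCommGroup N] [Module R N]
    [Module.Finite R N] (xs : List R)
    (h : IsGenRegSeq I (ModuleCat.of R N) xs)
    (hmax : ∀ x, ¬ IsGenRegSeq I (ModuleCat.of R N) (xs ++ [x])) :
    ¬ (Module.support R ((localCohomology I xs.length).obj (ModuleCat.of R N))).Finite := by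
  obtain ⟨p, hp, hd, hI⟩ := exists_ass I N xs h hmax
  have hpp : p.IsPrime := hp.isPrime
  have hG := gr_of_seq I N xs h p hd
  have hI1 : I ^ 1 ≤ p := by rwa [pow_one]
  apply Hr_infinite p hd
  apply Hr_not_Z p I N xs.length
  · intro j hj A _ _ hA
    exact part1 hG inferInstance j hj A hA
  · exact part2 hG inferInstance _ ⟨1, fun x hx a => quot_killed _ x hx a⟩ (not_Z_of_ass hI1 _ hp)

lemma dim_fin [IsNoetherianRing R] (I : Ideal R) (N : Type u) [AddCommGroup N] [Module R N]
    [Module.Finite R N] (xs : List R)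
    (h : IsGenRegSeq I (ModuleCat.of R N) xs) (J : Ideal R)
    (hJ : ∀ x, (∀ j < xs.length, ∀ e : EX (R := R) (R ⧸ I) N j, x • e = 0) → x ∈ J) :
    ringKrullDim (R ⧸ J) ≤ 1 := by
  apply dim_le_one
  intro p hp hJp hd
  have hG := gr_of_seq I N xs h p hd
  have h1 : ∀ j < xs.length, ∃ s, s ∉ p ∧ ∀ e : EX (R := R) (R ⧸ I) N j, s • e = 0 := by
    intro j hj
    apply Z.unif
    exact part1 hG inferInstance j hj _ ⟨1, fun x hx a => quot_killed _ x (by simpa using hx) a⟩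
  choose! s hs1 hs2 using h1
  have h2 : ∏ j ∈ Finset.range xs.length, s j ∈ J := by
    apply hJ
    intro j hj e
    obtain ⟨c, hc⟩ := Finset.dvd_prod_of_mem s (Finset.mem_range.2 hj)
    rw [hc, mul_comm, mul_smul, hs2 j hj, smul_zero]
  have h3 := hJp h2
  rw [Ideal.IsPrime.prod_mem_iff] at h3
  obtain ⟨j, hj, hj'⟩ := h3
  exact hs1 j (Finset.mem_range.1 hj) hj'

lemma dim_top [IsNoetherianRing R] (I : Ideal R) (N : Type u) [AddCommGroup N] [Module R N]
    [Module.Finite R N] (h : ∀ n : ℕ, ∃ xs : List R, IsGenRegSeq I (ModuleCat.of R N) xs ∧ n < xs.length)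
    (J : Ideal R) (hIJ : I ≤ J) (hN : Module.annihilator R N ≤ J) :
    ringKrullDim (R ⧸ J) ≤ 1 := by
  apply dim_le_one
  intro p hp hJp hd
  obtain ⟨n, hn⟩ := ENat.ne_top_iff_exists.1 (Ideal.height_ne_top (I := p) hp.ne_top)
  obtain ⟨xs, hxs, hlen⟩ := h n
  have := seq_bound I N xs hxs p hd (hIJ.trans hJp) (hN.trans hJp)
  rw [← hn] at this
  have := Nat.cast_le.1 this
  omega

end fin
end GDepth

open GDepth

variable {R : Type u} [CommRing R] [IsNoetherianRing R] [IsLocalRing R]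

theorem stmt_11 (I : Ideal R) (N : Type u) [AddCommGroup N] [Module R N] [Module.Finite R N]
    (r : ℕ∞) (hr : r = gdepth I (ModuleCat.of R N)) (Jr : Ideal R)
    (hJ : Jr = ⨅ (j : ℕ) (_ : (j : ℕ∞) < r),
      Module.annihilator R (extMod j (ModuleCat.of R (R ⧸ I)) (ModuleCat.of R N))) :
    ringKrullDim (R ⧸ Jr) ≤ (1 : WithBot ℕ∞) ∧
      r = sInf {i : ℕ∞ | ∃ j : ℕ, i = (j : ℕ∞) ∧
        ¬ (Module.support R ((localCohomology I j).obj (ModuleCat.of R N))).Finite} ∧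
      r = sInf {i : ℕ∞ | ∃ j : ℕ, i = (j : ℕ∞) ∧
        ¬ Nonempty ((localCohomology I j).obj (ModuleCat.of R N) ≃ₗ[R] (localCohomology Jr j).obj (ModuleCat.of R N))} := by
  have memJ : ∀ x, x ∈ Jr ↔ ∀ j : ℕ, (j : ℕ∞) < r → ∀ e : EX (R := R) (R ⧸ I) N j, x • e = 0 := by
    intro x
    rw [hJ]
    simp only [Submodule.mem_iInf, mem_ann_iff]
  have hIJ : I ≤ Jr := fun x hx => (memJ x).2 fun j _ e =>
    smul_eq_zero_left x (fun a => quot_killed I x hx a) j e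
  have hNJ : Module.annihilator R N ≤ Jr := fun x hx => (memJ x).2 fun j _ e =>
    smul_eq_zero_right x (fun a => Module.mem_annihilator.1 hx a) j e
  have hlen : ∀ xs : List R, IsGenRegSeq I (ModuleCat.of R N) xs → (xs.length : ℕ∞) ≤ r := by
    intro xs hxs
    rw [hr]
    exact le_sSup ⟨xs, hxs, rfl⟩
  have hfin : ∀ n : ℕ, r = n → ∃ xs : List R, IsGenRegSeq I (ModuleCat.of R N) xs ∧ xs.length = n := by
    intro n hn
    by_contra hcon
    push Not at hcon
    cases n with
    | zero => exact hcon [] ⟨by simp, fun i => i.elim0⟩ rfl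
    | succ n =>
      have : r ≤ n := by
        rw [hr]
        apply sSup_le
        rintro _ ⟨xs, hxs, rfl⟩
        have h1 := hlen xs hxs
        have h2 := hcon xs hxs
        rw [hn] at h1
        have h3 := Nat.cast_le.1 h1
        exact Nat.cast_le.2 (by omega)
      rw [hn] at this
      have := Nat.cast_le.1 this
      omega
  have hdim : ringKrullDim (R ⧸ Jr) ≤ 1 := by
    by_cases hrt : r = ⊤
    · refine dim_top I N ?_ Jr hIJ hNJ
      intro n
      have : (n : ℕ∞) < gdepth I (ModuleCat.of R N) := by
        rw [← hr, hrt]; exact ENat.natCast_lt_top n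
      obtain ⟨_, ⟨xs, hxs, rfl⟩, h⟩ := lt_sSup_iff.1 this
      exact ⟨xs, hxs, Nat.cast_lt.1 h⟩
    · obtain ⟨n, hn⟩ := ENat.ne_top_iff_exists.1 hrt
      obtain ⟨xs, hxs, hl⟩ := hfin n hn.symm
      refine dim_fin I N xs hxs Jr ?_
      intro x hx
      refine (memJ x).2 fun j hj => hx j ?_
      rw [← hn] at hj
      rw [hl]
      exact Nat.cast_lt.1 hj
  have hsJ : ∀ j : ℕ, (Module.support R ((localCohomology Jr j).obj (ModuleCat.of R N))).Finite :=
    fun j => (zl_finite Jr hdim).subset (support_lc Jr j)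
  have hiso : ∀ j : ℕ, (j : ℕ∞) < r → Nonempty ((localCohomology I j).obj (ModuleCat.of R N) ≃ₗ[R]
      (localCohomology Jr j).obj (ModuleCat.of R N)) := by
    intro j hj
    obtain ⟨φ⟩ := iso_lc (N := N) I Jr hIJ j (fun i hi x hx =>
      (memJ x).1 hx i (lt_of_le_of_lt (Nat.cast_le.2 hi) hj))
    exact ⟨φ.symm⟩
  have hinf : ∀ n : ℕ, r = n →
      ¬ (Module.support R ((localCohomology I n).obj (ModuleCat.of R N))).Finite := by
    intro n hn
    obtain ⟨xs, hxs, rfl⟩ := hfin n hn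
    apply inf_support I N xs hxs
    intro x hx
    have := hlen _ hx
    rw [hn] at this
    have := Nat.cast_le.1 this
    simp at this
  refine ⟨hdim, r_eq_sInf r _ ?_ hinf, r_eq_sInf r _ ?_ ?_⟩
  · intro j hj hcon
    obtain ⟨φ⟩ := hiso j hj
    apply hcon
    rw [φ.support_eq]
    exact hsJ j
  · intro j hj hcon
    exact hcon (hiso j hj)
  · rintro n hn ⟨φ⟩
    apply hinf n hn
    rw [φ.support_eq]
    exact hsJ n

end
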